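/- There is a constant c < 1 such that for every t ≥ 10, the random 2-complex X^2(n,p) with p = √(c/n) asymptotically almost surely (i.e., with probability tending to 1 as n → ∞) does NOT contain the complete 2-complex K_t^2 as a topological minor, i.e., contains no subcomplex isomorphic to a subdivision of K_t^2. -/

import Mathlib

open MeasureTheory Filter

/-- The Bernoulli measure on `Bool` with success probability `p`. -/
noncomputable def bernoulliBool (p : ℝ) : Measure Bool :=
  ENNReal.ofReal p • Measure.dirac true + ENNReal.ofReal (1 - p) • Measure.dirac false

/-- The random `k`-complex `X^k(n,p)`: the product Bernoulli(p) measure on indicator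
functions of the `(k+1)`-subsets of `[n]`. -/
noncomputable def complexMeasure (n k : ℕ) (p : ℝ) :
    Measure ({S : Finset (Fin n) // S.card = k + 1} → Bool) :=
  Measure.pi fun _ => bernoulliBool p

/-- Whether `F` is a face of the complex determined by a sample `ω`: all sets of
cardinality at most `k` are faces, and a `(k+1)`-set is a face iff its indicator is true. -/
def isFace {n k : ℕ} (ω : {S : Finset (Fin n) // S.card = k + 1} → Bool)
    (F : Finset (Fin n)) : Prop :=
  F.card ≤ k ∨ ∃ h : F.card = k + 1, ω ⟨F, h⟩ = true

/-- The simplicial complex (set system on `Fin n`) determined by a sample `ω`. -/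
def sampleComplex (n k : ℕ) (ω : {S : Finset (Fin n) // S.card = k + 1} → Bool) :
    Set (Finset (Fin n)) :=
  {F | isFace ω F}

/-- The vertex set of an abstract simplicial complex given as a set system. -/
def vertexSet {V : Type*} (X : Set (Finset V)) : Set V :=
  {v | ∃ F ∈ X, v ∈ F}

/-- `Δ` is a geometric realization of the abstract complex `X` via the vertex map `φ`:
`φ` is injective on the vertices of `X` and the faces of `Δ` are exactly the images of
the nonempty faces of `X`. -/
def IsRealization {V : Type*} {m : ℕ} (Δ : Geometry.SimplicialComplex ℝ (Fin m → ℝ))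
    (X : Set (Finset V)) (φ : V → (Fin m → ℝ)) : Prop :=
  letI : DecidableEq (Fin m → ℝ) := Classical.decEq _
  Set.InjOn φ (vertexSet X) ∧
    Δ.faces = {G | ∃ F ∈ X, F.Nonempty ∧ G = F.image φ}

/-- `Δ'` is a subdivision of `Δ`: same polyhedron, and every simplex of `Δ'` is
contained in some simplex of `Δ`. -/
def IsGeomSubdivision {m : ℕ} (Δ' Δ : Geometry.SimplicialComplex ℝ (Fin m → ℝ)) : Prop :=
  Δ'.space = Δ.space ∧
    ∀ G ∈ Δ'.faces, ∃ F ∈ Δ.faces,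
      convexHull ℝ (G : Set (Fin m → ℝ)) ⊆ convexHull ℝ (F : Set (Fin m → ℝ))

/-- The abstract complex `X'` is a subdivision of the abstract complex `X`. -/
def IsSubdivisionOf {V W : Type*} (X' : Set (Finset V)) (X : Set (Finset W)) : Prop :=
  ∃ (m : ℕ) (Δ Δ' : Geometry.SimplicialComplex ℝ (Fin m → ℝ))
    (φ : W → (Fin m → ℝ)) (φ' : V → (Fin m → ℝ)),
    IsRealization Δ X φ ∧ IsRealization Δ' X' φ' ∧ IsGeomSubdivision Δ' Δ

/-- `Y` contains `K` as a topological minor: some subcomplex of `Y` is isomorphic to a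
subdivision of `K`. -/
def ContainsTopMinor {V W : Type*} [DecidableEq V] (Y : Set (Finset V))
    (K : Set (Finset W)) : Prop :=
  ∃ (K' : Set (Finset ℕ)) (f : ℕ → V),
    IsSubdivisionOf K' K ∧ Set.InjOn f (vertexSet K') ∧ ∀ F ∈ K', F.image f ∈ Y

/-- The complete `k`-dimensional complex on `t` vertices. -/
def completeComplex (t k : ℕ) : Set (Finset ℕ) :=
  {F | F ⊆ Finset.range t ∧ F.card ≤ k + 1}

/-- Moves of a sweep: `Sum.inl x` inserts `x` behind the cursor, `Sum.inr true` deletes the vertex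
at the cursor, `Sum.inr false` advances the cursor. -/
abbrev SweepMove (α : Type*) := α ⊕ Bool

/-- The triangles swept by a sequence of moves. The front is the list `l.reverse ++ r`, and the
cursor is at the head of `l`. -/
def sweptTriangles {α : Type*} : List α → List α → List (SweepMove α) → List (α × α × α)
  | v :: l, w :: r, .inl x :: m => (v, x, w) :: sweptTriangles (v :: l) (x :: w :: r) m
  | v :: u :: l, w :: r, .inr true :: m => (u, v, w) :: sweptTriangles (u :: l) (w :: r) m
  | l, w :: r, .inr false :: m => sweptTriangles (w :: l) r m
  | _, _, _ => []

/-- The vertex set of a triangle. -/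
def triangleSet {α : Type*} [DecidableEq α] (τ : α × α × α) : Finset α := {τ.1, τ.2.1, τ.2.2}

theorem sweptTriangles_map {α β : Type*} (g : α → β) (m : List (SweepMove α)) :
    ∀ l r : List α, sweptTriangles (l.map g) (r.map g) (m.map (Sum.map g id)) =
      (sweptTriangles l r m).map (Prod.map g (Prod.map g g)) := by
  induction m with
  | nil => intro l r; rcases l with _ | ⟨v, _ | ⟨u, l⟩⟩ <;> rcases r with _ | ⟨w, r⟩ <;> rfl
  | cons c m ih =>
    intro l r
    rcases r with _ | ⟨w, r⟩
    · rcases c with x | _ | _ <;> rcases l with _ | ⟨v, _ | ⟨u, l⟩⟩ <;> rfl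
    · rcases c with x | _ | _
      · rcases l with _ | ⟨v, l⟩
        · rfl
        · simpa [sweptTriangles] using ih (v :: l) (x :: w :: r)
      · rcases l with _ | ⟨v, _ | ⟨u, l⟩⟩
        · simpa [sweptTriangles] using ih [w] r
        · simpa [sweptTriangles] using ih [w, v] r
        · simpa [sweptTriangles] using ih (w :: v :: u :: l) r
      · rcases l with _ | ⟨v, _ | ⟨u, l⟩⟩
        · rfl
        · rfl
        · simpa [sweptTriangles] using ih (u :: l) (w :: r)

/-- Twice the signed area of a triangle in the plane. -/
def signedArea (u v w : ℝ × ℝ) : ℝ :=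
  (v.1 - u.1) * (w.2 - u.2) - (w.1 - u.1) * (v.2 - u.2)

theorem signedArea_le_zero_of_mem_convexHull {u v q : ℝ × ℝ} {s : Set (ℝ × ℝ)}
    (hs : ∀ x ∈ s, signedArea u v x ≤ 0) (hq : q ∈ convexHull ℝ s) : signedArea u v q ≤ 0 := by
  have hc : Convex ℝ {x | signedArea u v x ≤ 0} := by
    intro x hx y hy a b ha hb hab
    simp only [Set.mem_ofPred_eq, signedArea] at hx hy ⊢
    simp only [Prod.fst_add, Prod.snd_add, Prod.smul_fst, Prod.smul_snd, smul_eq_mul]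
    obtain rfl : b = 1 - a := by linarith
    nlinarith [mul_nonneg ha (neg_nonneg.2 hx), mul_nonneg hb (neg_nonneg.2 hy)]
  exact convexHull_min (s := s) (fun x hx => hs x hx) hc hq

section Plane

open Geometry

variable {Δ : SimplicialComplex ℝ (ℝ × ℝ)}

theorem card_le_three_of_mem_faces {s : Finset (ℝ × ℝ)} (hs : s ∈ Δ.faces) : s.card ≤ 3 := by
  have := (Δ.indep hs).card_le_finrank_succ
  have h2 : Module.finrank ℝ (vectorSpan ℝ (Set.range ((↑) : s → ℝ × ℝ))) ≤ 2 := by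
    simpa using Submodule.finrank_le (vectorSpan ℝ (Set.range ((↑) : s → ℝ × ℝ)))
  simp at this
  omega

/-- A simplex without vertical edges containing a vertical segment is a triangle. -/
theorem three_le_card_of_vertical {s : Finset (ℝ × ℝ)} (hinj : Set.InjOn Prod.fst (s : Set (ℝ × ℝ)))
    {p : ℝ × ℝ} {ε : ℝ} (hε : 0 < ε) (hp : p ∈ convexHull ℝ (s : Set (ℝ × ℝ)))
    (hq : (p.1, p.2 + ε) ∈ convexHull ℝ (s : Set (ℝ × ℝ))) : 3 ≤ s.card := by
  by_contra! hlt
  have : s.card = 0 ∨ s.card = 1 ∨ s.card = 2 := by omega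
  rcases this with h | h | h
  · simp [Finset.card_eq_zero.1 h] at hp
  · obtain ⟨a, rfl⟩ := Finset.card_eq_one.1 h
    simp at hp hq
    subst hp
    have := congrArg Prod.snd hq
    simp at this
    linarith
  · obtain ⟨a, b, hab, rfl⟩ := Finset.card_eq_two.1 h
    simp only [Finset.coe_insert, Finset.coe_singleton, convexHull_pair] at hp hq
    obtain ⟨s, t, -, -, hst, rfl⟩ := hp
    obtain ⟨s', t', -, -, hst', h'⟩ := hq
    have hne : a.1 ≠ b.1 := fun h => hab (hinj (by simp) (by simp) h)
    have h1 := congrArg Prod.fst h'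
    have h2 := congrArg Prod.snd h'
    simp at h1 h2
    obtain rfl : s = 1 - t := by linarith
    obtain rfl : s' = 1 - t' := by linarith
    have : (t' - t) * (b.1 - a.1) = 0 := by linarith
    rcases mul_eq_zero.1 this with h | h
    · obtain rfl : t' = t := by linarith
      linarith
    · exact hne (by linarith)

theorem vertices_of_mem {s : Finset (ℝ × ℝ)} (hs : s ∈ Δ.faces) :
    (s : Set (ℝ × ℝ)) ⊆ Δ.vertices := by
  intro x hx
  exact Δ.down_closed hs (by simpa using hx) (by simp)

theorem eq_of_common_vertical (hinj : Set.InjOn Prod.fst Δ.vertices) {s t : Finset (ℝ × ℝ)}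
    (hs : s ∈ Δ.faces) (ht : t ∈ Δ.faces) {p : ℝ × ℝ} {ε δ : ℝ} (hε : 0 < ε) (hδ : 0 < δ)
    (hps : p ∈ convexHull ℝ (s : Set (ℝ × ℝ))) (hpt : p ∈ convexHull ℝ (t : Set (ℝ × ℝ)))
    (hqs : (p.1, p.2 + ε) ∈ convexHull ℝ (s : Set (ℝ × ℝ)))
    (hqt : (p.1, p.2 + δ) ∈ convexHull ℝ (t : Set (ℝ × ℝ))) : s = t := by
  have key : ∀ {r : Set (ℝ × ℝ)} {η : ℝ}, 0 < η → min ε δ ≤ η → p ∈ convexHull ℝ r →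
      (p.1, p.2 + η) ∈ convexHull ℝ r → (p.1, p.2 + min ε δ) ∈ convexHull ℝ r := by
    intro r η hη hle h1 h2
    have hm : 0 < min ε δ := lt_min hε hδ
    have := (convex_convexHull ℝ r) h1 h2 (a := 1 - min ε δ / η) (b := min ε δ / η)
      (by rw [sub_nonneg, div_le_one hη]; exact hle) (by positivity) (by ring)
    convert this using 1
    ext
    · simp; ring
    · simp; field_simp; ring
  have h1 : p ∈ convexHull ℝ ((s ∩ t : Finset (ℝ × ℝ)) : Set (ℝ × ℝ)) := by
    rw [Finset.coe_inter]
    exact Δ.inter_subset_convexHull hs ht ⟨hps, hpt⟩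
  have h2 : (p.1, p.2 + min ε δ) ∈ convexHull ℝ ((s ∩ t : Finset (ℝ × ℝ)) : Set (ℝ × ℝ)) := by
    rw [Finset.coe_inter]
    exact Δ.inter_subset_convexHull hs ht
      ⟨key hε (min_le_left _ _) hps hqs, key hδ (min_le_right _ _) hpt hqt⟩
  have h3 := three_le_card_of_vertical (hinj.mono fun x hx => vertices_of_mem hs
    (Finset.mem_coe.2 (Finset.mem_inter.1 (Finset.mem_coe.1 hx)).1)) (lt_min hε hδ) h1 h2
  have e1 := Finset.eq_of_subset_of_card_le (Finset.inter_subset_left (s₁ := s) (s₂ := t))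
    ((card_le_three_of_mem_faces hs).trans h3)
  have e2 := Finset.eq_of_subset_of_card_le (Finset.inter_subset_right (s₁ := s) (s₂ := t))
    ((card_le_three_of_mem_faces ht).trans h3)
  exact e1.symm.trans e2

theorem exists_face_above (hfin : Δ.faces.Finite) (hup : ∀ q ∈ Δ.space, ∀ y, q.2 ≤ y → y ≤ 0 →
    (q.1, y) ∈ Δ.space) {p : ℝ × ℝ} (hp : p ∈ Δ.space) (hp0 : p.2 < 0) :
    ∃ s ∈ Δ.faces, ∃ ε > 0, p ∈ convexHull ℝ (s : Set (ℝ × ℝ)) ∧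
      (p.1, p.2 + ε) ∈ convexHull ℝ (s : Set (ℝ × ℝ)) := by
  have hclosed : IsClosed (⋃ s ∈ {s ∈ Δ.faces | p ∉ convexHull ℝ (s : Set (ℝ × ℝ))},
      convexHull ℝ (s : Set (ℝ × ℝ))) :=
    (hfin.subset (Set.sep_subset _ _)).isClosed_biUnion
      fun s _ => (s.finite_toSet.isCompact_convexHull ℝ).isClosed
  have hcont : Tendsto (fun ε : ℝ => (p.1, p.2 + ε)) (nhdsWithin 0 (Set.Ioi 0)) (nhds p) := by
    have : Continuous (fun ε : ℝ => (p.1, p.2 + ε)) := by fun_prop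
    simpa using (this.tendsto 0).mono_left nhdsWithin_le_nhds
  have hev := hcont.eventually (hclosed.isOpen_compl.mem_nhds (x := p) (by simp))
  have hev2 : ∀ᶠ ε : ℝ in nhdsWithin 0 (Set.Ioi 0), ε ∈ Set.Ioo 0 (-p.2) :=
    Ioo_mem_nhdsGT (by linarith)
  obtain ⟨ε, h1, h2, h3⟩ := (hev.and hev2).exists
  obtain ⟨s, hs, hqs⟩ := SimplicialComplex.mem_space_iff.1
    (hup p hp (p.2 + ε) (by linarith) (by linarith))
  refine ⟨s, hs, ε, h2, ?_, hqs⟩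
  by_contra hps
  exact h1 (Set.mem_biUnion (show s ∈ {s ∈ Δ.faces | p ∉ convexHull ℝ (s : Set (ℝ × ℝ))} from
    ⟨hs, hps⟩) hqs)

/-- The triangle directly above an edge. -/
theorem exists_triangle_above (hfin : Δ.faces.Finite)
    (hup : ∀ q ∈ Δ.space, ∀ y, q.2 ≤ y → y ≤ 0 → (q.1, y) ∈ Δ.space)
    (hinj : Set.InjOn Prod.fst Δ.vertices) {v w : ℝ × ℝ} (hvw : v.1 < w.1)
    (he : {v, w} ∈ Δ.faces) (hneg : v.2 + w.2 < 0) :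
    ∃ x, {v, w, x} ∈ Δ.faces ∧ 0 < signedArea v w x := by
  set p : ℝ × ℝ := ((v.1 + w.1) / 2, (v.2 + w.2) / 2) with hp
  have hpe : p ∈ convexHull ℝ (({v, w} : Finset (ℝ × ℝ)) : Set (ℝ × ℝ)) := by
    simp only [Finset.coe_insert, Finset.coe_singleton, convexHull_pair]
    refine ⟨1 / 2, 1 / 2, by norm_num, by norm_num, by norm_num, ?_⟩
    ext <;> simp [hp] <;> ring
  obtain ⟨s, hs, ε, hε, hps, hqs⟩ := exists_face_above hfin hup
    (SimplicialComplex.convexHull_subset_space he hpe) (by simp [hp]; linarith)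
  have hcard : s.card = 3 := le_antisymm (card_le_three_of_mem_faces hs)
    (three_le_card_of_vertical (hinj.mono (vertices_of_mem hs)) hε hps hqs)
  have hmem := Δ.inter_subset_convexHull he hs ⟨hpe, hps⟩
  have hv : v ∈ s := by
    by_contra hv
    have : p ∈ convexHull ℝ ({w} : Set (ℝ × ℝ)) := by
      refine convexHull_mono ?_ hmem
      rintro x ⟨hx, hxs⟩
      simp at hx hxs
      rcases hx with rfl | rfl
      · exact absurd hxs hv
      · rfl
    simp at this
    have := congrArg Prod.fst this
    simp [hp] at this
    linarith
  have hw : w ∈ s := by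
    by_contra hw
    have : p ∈ convexHull ℝ ({v} : Set (ℝ × ℝ)) := by
      refine convexHull_mono ?_ hmem
      rintro x ⟨hx, hxs⟩
      simp at hx hxs
      rcases hx with rfl | rfl
      · rfl
      · exact absurd hxs hw
    simp at this
    have := congrArg Prod.fst this
    simp [hp] at this
    linarith
  have hne : v ≠ w := fun h => by simp [h] at hvw
  obtain ⟨x, hx⟩ : ∃ x, x ∈ s \ {v, w} := by
    apply Finset.card_pos.1
    rw [Finset.card_sdiff_of_subset (by simp [Finset.insert_subset_iff, hv, hw]), hcard,
      Finset.card_pair hne]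
    norm_num
  simp at hx
  have hseq : s = {v, w, x} := by
    symm
    apply Finset.eq_of_subset_of_card_le
    · simp [Finset.insert_subset_iff, hv, hw, hx.1]
    · rw [hcard, Finset.card_eq_three.2 ⟨v, w, x, hne, Ne.symm hx.2.1, Ne.symm hx.2.2, rfl⟩]
  refine ⟨x, hseq ▸ hs, ?_⟩
  by_contra! hle
  have := signedArea_le_zero_of_mem_convexHull (u := v) (v := w) (s := s) (by
    intro y hy
    rw [hseq] at hy
    simp at hy
    rcases hy with rfl | rfl | rfl
    · simp [signedArea]
    · simp [signedArea]
    · exact hle) hqs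
  simp only [signedArea, hp] at this
  nlinarith [mul_pos (sub_pos.2 hvw) hε]

/-- Two triangles with a common middle vertex lying below both of them agree. -/
theorem triangles_above_vertex_eq (hinj : Set.InjOn Prod.fst Δ.vertices) {u v y a b : ℝ × ℝ}
    (h1 : {u, v, y} ∈ Δ.faces) (h2 : {a, v, b} ∈ Δ.faces) (huv : u.1 < v.1) (hvy : v.1 < y.1)
    (hav : a.1 < v.1) (hvb : v.1 < b.1) (hs1 : 0 < signedArea u v y) (hs2 : 0 < signedArea a v b) :
    a = u ∧ b = y := by
  have key : ∀ {u v y : ℝ × ℝ}, u.1 < v.1 → v.1 < y.1 → 0 < signedArea u v y →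
      (v.1, v.2 + signedArea u v y / (y.1 - u.1)) ∈
        convexHull ℝ (({u, v, y} : Finset (ℝ × ℝ)) : Set (ℝ × ℝ)) := by
    intro u v y huv hvy hs
    have hpos : 0 < y.1 - u.1 := by linarith
    have hsub : segment ℝ u y ⊆ convexHull ℝ (({u, v, y} : Finset (ℝ × ℝ)) : Set (ℝ × ℝ)) :=
      (convex_convexHull ℝ _).segment_subset (subset_convexHull _ _ (by simp))
        (subset_convexHull _ _ (by simp))
    refine hsub ⟨(y.1 - v.1) / (y.1 - u.1), (v.1 - u.1) / (y.1 - u.1),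
      div_nonneg (by linarith) hpos.le, div_nonneg (by linarith) hpos.le, by field_simp; ring, ?_⟩
    ext
    · simp; field_simp; ring
    · simp [signedArea]; field_simp; ring
  have heq := eq_of_common_vertical hinj h1 h2 (p := v)
    (div_pos hs1 (by linarith)) (div_pos hs2 (by linarith))
    (subset_convexHull _ _ (by simp)) (subset_convexHull _ _ (by simp))
    (key huv hvy hs1) (key hav hvb hs2)
  have ha : a ∈ ({u, v, y} : Finset (ℝ × ℝ)) := by rw [heq]; simp
  have hb : b ∈ ({u, v, y} : Finset (ℝ × ℝ)) := by rw [heq]; simp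
  simp at ha hb
  constructor
  · rcases ha with rfl | rfl | rfl
    · rfl
    · linarith
    · linarith
  · rcases hb with rfl | rfl | rfl
    · linarith
    · linarith
    · rfl

end Plane

/-- The number of insertions. -/
def insCount {α : Type*} (m : List (SweepMove α)) : ℕ := m.countP Sum.isLeft

/-- The number of deletions. -/
def delCount {α : Type*} (m : List (SweepMove α)) : ℕ :=
  m.countP (Sum.elim (fun _ => false) id)

/-- The number of cursor advances. -/
def skipCount {α : Type*} (m : List (SweepMove α)) : ℕ :=
  m.countP (Sum.elim (fun _ => false) not)

section Sweep

open Geometry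

variable {Δ : SimplicialComplex ℝ (ℝ × ℝ)}

/-- The moves `m` sweep the complex `Δ` from the front given by `l` and `r` up to the line `y = 0`,
using no triangle from `P`. -/
structure IsSweep (Δ : SimplicialComplex ℝ (ℝ × ℝ)) (P : Finset (Finset (ℝ × ℝ)))
    (l r : List (ℝ × ℝ)) (m : List (SweepMove (ℝ × ℝ))) : Prop where
  nodup : ((sweptTriangles l r m).map triangleSet).Nodup
  mem : ∀ s ∈ (sweptTriangles l r m).map triangleSet, s ∈ Δ.faces ∧ s.card = 3 ∧ s ∉ P
  length : (sweptTriangles l r m).length = insCount m + delCount m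
  skip : skipCount m = r.length + insCount m
  final : ∃ f : List (ℝ × ℝ), f.Nodup ∧ (∀ q ∈ f, q ∈ Δ.vertices ∧ q.2 = 0) ∧
    f.length + delCount m = l.length + r.length + insCount m ∧
    f.length ≤ l.countP (fun q => q.2 = 0) + r.countP (fun q => q.2 = 0) + insCount m

theorem IsSweep.advance {P : Finset (Finset (ℝ × ℝ))} {l r : List (ℝ × ℝ)} {w : ℝ × ℝ}
    {m : List (SweepMove (ℝ × ℝ))} (h : IsSweep Δ P (w :: l) r m) :
    IsSweep Δ P l (w :: r) (.inr false :: m) := by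
  have hs : sweptTriangles l (w :: r) (.inr false :: m) = sweptTriangles (w :: l) r m := by
    rcases l with _ | ⟨v, _ | ⟨u, l⟩⟩ <;> rfl
  obtain ⟨h1, h2, h3, h4, f, h5, h6, h7, h8⟩ := h
  refine ⟨by rwa [hs], by rwa [hs], ?_, ?_, f, h5, h6, ?_, ?_⟩
  · simpa [hs, insCount, delCount] using h3
  · simp [skipCount, insCount] at h4 ⊢; omega
  · simp [delCount, insCount] at h7 ⊢; omega
  · simp [insCount, List.countP_cons] at h8 ⊢; omega

theorem IsSweep.insert {P : Finset (Finset (ℝ × ℝ))} {l r : List (ℝ × ℝ)} {v w x : ℝ × ℝ}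
    {m : List (SweepMove (ℝ × ℝ))} (hf : {v, x, w} ∈ Δ.faces)
    (hc : ({v, x, w} : Finset (ℝ × ℝ)).card = 3) (hP : {v, x, w} ∉ P)
    (h : IsSweep Δ (insert {v, x, w} P) (v :: l) (x :: w :: r) m) :
    IsSweep Δ P (v :: l) (w :: r) (.inl x :: m) := by
  obtain ⟨h1, h2, h3, h4, f, h5, h6, h7, h8⟩ := h
  refine ⟨?_, ?_, ?_, ?_, f, h5, h6, ?_, ?_⟩
  · simp only [sweptTriangles, List.map_cons, List.nodup_cons]
    exact ⟨fun hmem => (h2 _ hmem).2.2 (by simp [triangleSet]), h1⟩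
  · simp only [sweptTriangles, List.map_cons, List.mem_cons]
    rintro s (rfl | hs)
    · exact ⟨hf, hc, hP⟩
    · have := h2 s hs
      simp only [Finset.mem_insert, not_or] at this
      exact ⟨this.1, this.2.1, this.2.2.2⟩
  · simp [List.countP_cons, sweptTriangles, insCount, delCount] at h3 ⊢; omega
  · simp [List.countP_cons, skipCount, insCount] at h4 ⊢; omega
  · simp [List.countP_cons, delCount, insCount] at h7 ⊢; omega
  · simp only [insCount, List.countP_cons] at h8 ⊢
    simp at h8 ⊢
    split_ifs at h8 ⊢ <;> omega

theorem IsSweep.delete {P : Finset (Finset (ℝ × ℝ))} {l r : List (ℝ × ℝ)} {u v w : ℝ × ℝ}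
    {m : List (SweepMove (ℝ × ℝ))} (hf : {u, v, w} ∈ Δ.faces)
    (hc : ({u, v, w} : Finset (ℝ × ℝ)).card = 3) (hP : {u, v, w} ∉ P)
    (h : IsSweep Δ (Insert.insert {u, v, w} P) (u :: l) (w :: r) m) :
    IsSweep Δ P (v :: u :: l) (w :: r) (.inr true :: m) := by
  obtain ⟨h1, h2, h3, h4, f, h5, h6, h7, h8⟩ := h
  refine ⟨?_, ?_, ?_, ?_, f, h5, h6, ?_, ?_⟩
  · simp only [sweptTriangles, List.map_cons, List.nodup_cons]
    exact ⟨fun hmem => (h2 _ hmem).2.2 (by simp [triangleSet]), h1⟩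
  · simp only [sweptTriangles, List.map_cons, List.mem_cons]
    rintro s (rfl | hs)
    · exact ⟨hf, hc, hP⟩
    · have := h2 s hs
      simp only [Finset.mem_insert, not_or] at this
      exact ⟨this.1, this.2.1, this.2.2.2⟩
  · simp [List.countP_cons, sweptTriangles, insCount, delCount] at h3 ⊢; omega
  · simp [skipCount, insCount] at h4 ⊢; omega
  · simp [List.countP_cons, delCount, insCount] at h7 ⊢; omega
  · simp only [insCount, List.countP_cons] at h8 ⊢
    simp at h8 ⊢
    split_ifs at h8 ⊢ <;> omega

/-- A relation holds between consecutive vertices of a front. -/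
def FrontChain {α : Type*} (R : α → α → Prop) (v : α) (l r : List α) : Prop :=
  (v :: l).IsChain (flip R) ∧ (v :: r).IsChain R

section FrontChain

variable {α : Type*} {R : α → α → Prop} {u v w x : α} {l r : List α}

theorem frontChain_advance : FrontChain R v l (w :: r) ↔ FrontChain R w (v :: l) r := by
  simp only [FrontChain, List.isChain_cons_cons, flip]
  tauto

theorem FrontChain.insert (h : FrontChain R v l (w :: r)) (h1 : R v x) (h2 : R x w) :
    FrontChain R v l (x :: w :: r) := by
  simp only [FrontChain, List.isChain_cons_cons] at h ⊢
  tauto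

theorem FrontChain.delete (h : FrontChain R v (u :: l) (w :: r)) (h1 : R u w) :
    FrontChain R u l (w :: r) := by
  simp only [FrontChain, List.isChain_cons_cons] at h ⊢
  tauto

end FrontChain

/-- Consecutive vertices of a front: an edge directed from left to right. -/
def FrontEdge (Δ : SimplicialComplex ℝ (ℝ × ℝ)) (u w : ℝ × ℝ) : Prop :=
  u.1 < w.1 ∧ {u, w} ∈ Δ.faces

/-- The edge `u w` cannot be advanced before the next edge is: it is on the line `y = 0`, or the
middle vertex of the triangle above it is its right endpoint. -/
def IsBlocked (Δ : SimplicialComplex ℝ (ℝ × ℝ)) (u w : ℝ × ℝ) : Prop :=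
  (u.2 = 0 ∧ w.2 = 0) ∨ ∃ y, {u, w, y} ∈ Δ.faces ∧ w.1 < y.1 ∧ 0 < signedArea u w y

/-- The point `q` is not above the edge `u w`. -/
def IsUnder (q u w : ℝ × ℝ) : Prop := u.1 ≤ q.1 → q.1 < w.1 → signedArea u w q ≤ 0

/-- The centroid of a triangle. -/
noncomputable def centroidPoint (s : Finset (ℝ × ℝ)) : ℝ × ℝ := (1 / 3 : ℝ) • ∑ p ∈ s, p

theorem isUnder_left {q : ℝ × ℝ} : ∀ {l : List (ℝ × ℝ)} {v : ℝ × ℝ},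
    (v :: l).IsChain (flip (FrontEdge Δ)) → v.1 ≤ q.1 → (v :: l).IsChain (flip (IsUnder q))
  | [], _, _, _ => by simp
  | u :: l, v, h, hq => by
    rw [List.isChain_cons_cons] at h ⊢
    exact ⟨fun _ h2 => absurd h2 (not_lt.2 hq), isUnder_left h.2 (h.1.1.le.trans hq)⟩

theorem isUnder_right {q : ℝ × ℝ} : ∀ {r : List (ℝ × ℝ)} {w : ℝ × ℝ},
    (w :: r).IsChain (FrontEdge Δ) → q.1 < w.1 → (w :: r).IsChain (IsUnder q)
  | [], _, _, _ => by simp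
  | u :: r, v, h, hq => by
    rw [List.isChain_cons_cons] at h ⊢
    exact ⟨fun h2 => absurd hq (not_lt.2 h2), isUnder_right h.2 (hq.trans h.1.1)⟩

theorem centroidPoint_triple {u v w : ℝ × ℝ} (h1 : u.1 < v.1) (h2 : v.1 < w.1) :
    centroidPoint {u, v, w} = ((u.1 + v.1 + w.1) / 3, (u.2 + v.2 + w.2) / 3) := by
  have huv : u ≠ v := by rintro rfl; exact lt_irrefl _ h1
  have hvw : v ≠ w := by rintro rfl; exact lt_irrefl _ h2
  have huw : u ≠ w := by rintro rfl; exact lt_irrefl _ (h1.trans h2)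
  rw [centroidPoint, Finset.sum_insert (by simp [huv, huw]), Finset.sum_pair hvw]
  ext <;> simp <;> ring

theorem card_triple {u v w : ℝ × ℝ} (h1 : u.1 < v.1) (h2 : v.1 < w.1) :
    ({u, v, w} : Finset (ℝ × ℝ)).card = 3 := by
  have huv : u ≠ v := by rintro rfl; exact lt_irrefl _ h1
  have hvw : v ≠ w := by rintro rfl; exact lt_irrefl _ h2
  have huw : u ≠ w := by rintro rfl; exact lt_irrefl _ (h1.trans h2)
  exact Finset.card_eq_three.2 ⟨u, v, w, huv, huw, hvw, rfl⟩

theorem IsUnder.insert {q v w x : ℝ × ℝ} (h : IsUnder q v w) (hvx : v.1 < x.1) (hxw : x.1 < w.1)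
    (hs : 0 < signedArea v w x) : IsUnder q v x ∧ IsUnder q x w := by
  constructor
  · intro h1 h2
    have h3 := h h1 (h2.trans hxw)
    simp only [signedArea] at *
    have : (w.1 - v.1) * ((x.1 - v.1) * (q.2 - v.2) - (q.1 - v.1) * (x.2 - v.2)) ≤ 0 := by
      nlinarith [mul_nonneg (sub_nonneg.2 hvx.le) (neg_nonneg.2 h3),
        mul_nonneg (sub_nonneg.2 h1) hs.le]
    by_contra! hlt
    have := mul_pos (by linarith : 0 < w.1 - v.1) hlt
    linarith
  · intro h1 h2
    have h3 := h (hvx.le.trans h1) h2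
    simp only [signedArea] at *
    have : (w.1 - v.1) * ((w.1 - x.1) * (q.2 - x.2) - (q.1 - x.1) * (w.2 - x.2)) ≤ 0 := by
      nlinarith [mul_nonneg (sub_nonneg.2 hxw.le) (neg_nonneg.2 h3),
        mul_nonneg (sub_nonneg.2 h2.le) hs.le]
    by_contra! hlt
    have := mul_pos (by linarith : 0 < w.1 - v.1) hlt
    linarith

theorem IsUnder.delete {q u v w : ℝ × ℝ} (h : IsUnder q u v) (h' : IsUnder q v w) (huv : u.1 < v.1)
    (hvw : v.1 < w.1) (hs : 0 < signedArea u v w) : IsUnder q u w := by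
  intro h1 h2
  rcases lt_or_ge q.1 v.1 with hq | hq
  · have h3 := h h1 hq
    simp only [signedArea] at *
    have : (v.1 - u.1) * ((w.1 - u.1) * (q.2 - u.2) - (q.1 - u.1) * (w.2 - u.2)) ≤ 0 := by
      nlinarith [mul_nonneg (by linarith : 0 ≤ w.1 - u.1) (neg_nonneg.2 h3),
        mul_nonneg (sub_nonneg.2 h1) hs.le]
    by_contra! hlt
    have := mul_pos (by linarith : 0 < v.1 - u.1) hlt
    linarith
  · have h3 := h' hq h2
    simp only [signedArea] at *
    have : (w.1 - v.1) * ((w.1 - u.1) * (q.2 - u.2) - (q.1 - u.1) * (w.2 - u.2)) ≤ 0 := by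
      nlinarith [mul_nonneg (by linarith : 0 ≤ w.1 - u.1) (neg_nonneg.2 h3),
        mul_nonneg (sub_nonneg.2 h2.le) hs.le]
    by_contra! hlt
    have := mul_pos (by linarith : 0 < w.1 - v.1) hlt
    linarith

/-- If the cursor has reached the line `y = 0` behind blocked edges only, the whole front is
contained in this line. -/
theorem snd_eq_zero_of_isBlocked (hneg : ∀ q ∈ Δ.vertices, q.2 ≤ 0) : ∀ {l : List (ℝ × ℝ)}
    {v : ℝ × ℝ}, (v :: l).IsChain (flip (FrontEdge Δ)) → (v :: l).IsChain (flip (IsBlocked Δ)) →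
      v.2 = 0 → ∀ q ∈ v :: l, q.2 = 0
  | [], _, _, _, hv => by simpa using hv
  | u :: l, v, he, hb, hv => by
    rw [List.isChain_cons_cons] at he hb
    have hu : u.2 = 0 := by
      rcases hb.1 with h | ⟨y, hy, hvy, hs⟩
      · exact h.1
      · exfalso
        have hu0 := hneg u (vertices_of_mem hy (by simp))
        have hy0 := hneg y (vertices_of_mem hy (by simp))
        have huv : u.1 < v.1 := he.1.1
        simp only [signedArea, hv] at hs
        nlinarith
    have := snd_eq_zero_of_isBlocked hneg he.2 hb.2 hu
    intro q hq
    rcases List.mem_cons.1 hq with rfl | hq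
    · exact hv
    · exact this q hq

theorem exists_isSweep (hfin : Δ.faces.Finite)
    (hbox : ∀ q ∈ Δ.space, -1 ≤ q.1 ∧ q.1 ≤ 1 ∧ q.2 ≤ 0)
    (hup : ∀ q ∈ Δ.space, ∀ y, q.2 ≤ y → y ≤ 0 → (q.1, y) ∈ Δ.space)
    (hinj : Set.InjOn Prod.fst Δ.vertices) (k : ℕ) :
    ∀ (r : List (ℝ × ℝ)) (v : ℝ × ℝ) (l : List (ℝ × ℝ)) (P : Finset (Finset (ℝ × ℝ))),
      (hfin.toFinset \ P).card ≤ k → v ∈ Δ.vertices → FrontChain (FrontEdge Δ) v l r →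
      (v :: l).IsChain (flip (IsBlocked Δ)) →
      (∀ s ∈ P, FrontChain (IsUnder (centroidPoint s)) v l r) →
      (v :: l).getLast? = some (-1, 0) → (v :: r).getLast? = some (1, 0) →
      ∃ m, IsSweep Δ P (v :: l) r m := by
  have hvbox : ∀ q ∈ Δ.vertices, -1 ≤ q.1 ∧ q.1 ≤ 1 ∧ q.2 ≤ 0 := fun q hq =>
    hbox q (SimplicialComplex.vertices_subset_space hq)
  induction k using Nat.strong_induction_on with
  | _ k ihk =>
  intro r
  induction r with
  | nil =>
    intro v l P _ hv hedge hblock _ _ hlast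
    have hv0 : v = (1, 0) := by simpa using hlast
    have hzero := snd_eq_zero_of_isBlocked (fun q hq => (hvbox q hq).2.2) hedge.1 hblock
      (by rw [hv0])
    refine ⟨[], ⟨?_, ?_, ?_, ?_, v :: l, ?_, ?_, ?_, ?_⟩⟩
    · rcases l with _ | ⟨u, l⟩ <;> simp [sweptTriangles]
    · rcases l with _ | ⟨u, l⟩ <;> simp [sweptTriangles]
    · rcases l with _ | ⟨u, l⟩ <;> simp [sweptTriangles, insCount, delCount]
    · simp [skipCount, insCount]
    · have h1 : (v :: l).IsChain (fun a b => b.1 < a.1) := hedge.1.imp fun a b h => h.1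
      have : IsTrans (ℝ × ℝ) (fun a b => b.1 < a.1) := ⟨fun a b c h h' => h'.trans h⟩
      exact h1.pairwise.imp fun h e => by simp [e] at h
    · intro q hq
      refine ⟨?_, hzero q hq⟩
      have aux : ∀ (l : List (ℝ × ℝ)) (v : ℝ × ℝ), v ∈ Δ.vertices →
          (v :: l).IsChain (flip (FrontEdge Δ)) → ∀ q ∈ v :: l, q ∈ Δ.vertices := by
        intro l
        induction l with
        | nil => intro v hv _ q hq; simpa [List.mem_singleton.1 hq] using hv
        | cons u l ih =>
          intro v hv h q hq
          rw [List.isChain_cons_cons] at h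
          rcases List.mem_cons.1 hq with rfl | hq
          · exact hv
          · exact ih u (vertices_of_mem h.1.2 (by simp)) h.2 q hq
      exact aux l v hv hedge.1 q hq
    · simp [delCount, insCount]
    · simp only [List.countP_nil, insCount, add_zero]
      exact (List.countP_eq_length.2 (by simpa using hzero)).ge
  | cons w r ihr =>
    intro v l P hk hv hedge hblock hunder hfirst hlast
    have hvw : v.1 < w.1 := (List.isChain_cons_cons.1 hedge.2).1.1
    have hvwf : {v, w} ∈ Δ.faces := (List.isChain_cons_cons.1 hedge.2).1.2
    have hw : w ∈ Δ.vertices := vertices_of_mem hvwf (by simp)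
    have advance : IsBlocked Δ v w → ∃ m, IsSweep Δ P (v :: l) (w :: r) m := by
      intro hb
      obtain ⟨m, hm⟩ := ihr w (v :: l) P hk hw (frontChain_advance.1 hedge)
        (List.isChain_cons_cons.2 ⟨hb, hblock⟩) (fun s hs => frontChain_advance.1 (hunder s hs))
        (by simpa using hfirst) (by simpa using hlast)
      exact ⟨_, hm.advance⟩
    have hcard : ∀ s ∈ Δ.faces, s ∉ P → (hfin.toFinset \ insert s P).card < k := by
      intro s hs hsP
      refine (Finset.card_lt_card ?_).trans_le hk
      refine Finset.ssubset_iff_of_subset (Finset.sdiff_subset_sdiff le_rfl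
        (Finset.subset_insert _ _)) |>.2 ⟨s, by simp [hs, hsP], by simp⟩
    have hv2 := (hvbox v hv).2.2
    have hw2 := (hvbox w hw).2.2
    by_cases htop : v.2 = 0 ∧ w.2 = 0
    · exact advance (Or.inl htop)
    have hneg : v.2 + w.2 < 0 := by
      by_contra! h
      exact htop ⟨by linarith, by linarith⟩
    obtain ⟨x, hxf, hxs⟩ := exists_triangle_above hfin hup hinj hvw hvwf hneg
    have hx : x ∈ Δ.vertices := vertices_of_mem hxf (by simp)
    have hxv : x.1 ≠ v.1 := fun h => by
      rw [hinj hx hv h] at hxs; simp [signedArea] at hxs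
    have hxw : x.1 ≠ w.1 := fun h => by
      rw [hinj hx hw h] at hxs; simp [signedArea] at hxs
    rcases lt_or_gt_of_ne hxw with hxw | hxw
    swap
    · exact advance (Or.inr ⟨x, hxf, hxw, hxs⟩)
    rcases lt_or_gt_of_ne hxv with hxv | hxv
    · rcases l with _ | ⟨u, l⟩
      · obtain rfl : v = (-1, 0) := by simpa using hfirst
        linarith [(hvbox x hx).1]
      have huv : u.1 < v.1 := (List.isChain_cons_cons.1 hedge.1).1.1
      rcases (List.isChain_cons_cons.1 hblock).1 with ⟨-, h0⟩ | ⟨y, hyf, hvy, hys⟩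
      · exfalso
        have hx2 := (hvbox x hx).2.2
        simp only [signedArea, h0] at hxs
        nlinarith
      have hperm : ({v, w, x} : Finset (ℝ × ℝ)) = {x, v, w} := by ext; simp; tauto
      have hsa : signedArea v w x = signedArea x v w := by simp only [signedArea]; ring
      obtain ⟨rfl, rfl⟩ := triangles_above_vertex_eq hinj hyf (hperm ▸ hxf) huv hvy hxv hvw hys
        (hsa ▸ hxs)
      have hP : {x, v, w} ∉ P := by
        intro hmem
        have h := hunder _ hmem
        rw [centroidPoint_triple hxv hvw] at h
        have h1 := (List.isChain_cons_cons.1 h.1).1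
        have h2 := (List.isChain_cons_cons.1 h.2).1
        simp only [flip, IsUnder, signedArea] at h1 h2 hys
        rcases lt_or_ge ((x.1 + v.1 + w.1) / 3) v.1 with hc | hc
        · have := h1 (by linarith) hc
          nlinarith
        · have := h2 hc (by linarith)
          nlinarith
      obtain ⟨m, hm⟩ := ihk _ (hcard _ hyf hP) (w :: r) x l (insert {x, v, w} P) le_rfl
        hx (hedge.delete ⟨hxv.trans hvw, Δ.down_closed hyf (by
          simp [Finset.insert_subset_iff]) (by simp)⟩)
        (List.isChain_cons_cons.1 hblock).2 (by
          intro s hs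
          rcases Finset.mem_insert.1 hs with rfl | hs
          · have hd := hedge.delete (u := x) ⟨hxv.trans hvw, Δ.down_closed hyf (by
              simp [Finset.insert_subset_iff]) (by simp)⟩
            rw [centroidPoint_triple hxv hvw]
            refine ⟨isUnder_left hd.1 (by simp; linarith), List.isChain_cons_cons.2 ⟨?_,
              isUnder_right (List.isChain_cons_cons.1 hd.2).2 (by simp; linarith)⟩⟩
            intro _ _
            simp only [signedArea] at hys ⊢
            nlinarith
          · have h := hunder s hs
            exact h.delete (((List.isChain_cons_cons.1 h.1).1 : IsUnder _ _ _).delete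
              (List.isChain_cons_cons.1 h.2).1 hxv hvw hys))
        (by simpa using hfirst) (by simpa using hlast)
      exact ⟨_, hm.delete hyf (card_triple hxv hvw) hP⟩
    · have hperm : ({v, w, x} : Finset (ℝ × ℝ)) = {v, x, w} := by ext; simp; tauto
      rw [hperm] at hxf
      have hP : {v, x, w} ∉ P := by
        intro hmem
        have h := hunder _ hmem
        rw [centroidPoint_triple hxv hxw] at h
        have h2 := (List.isChain_cons_cons.1 h.2).1 (by simp; linarith) (by simp; linarith)
        simp only [signedArea] at h2 hxs
        nlinarith
      have hd := hedge.insert (x := x) ⟨hxv, Δ.down_closed hxf (by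
          simp [Finset.insert_subset_iff]) (by simp)⟩ ⟨hxw, Δ.down_closed hxf (by
          simp) (by simp)⟩
      obtain ⟨m, hm⟩ := ihk _ (hcard _ hxf hP) (x :: w :: r) v l (insert {v, x, w} P) le_rfl
        hv hd hblock (by
          intro s hs
          rcases Finset.mem_insert.1 hs with rfl | hs
          · rw [centroidPoint_triple hxv hxw]
            have h3 := (List.isChain_cons_cons.1 (List.isChain_cons_cons.1 hd.2).2).2
            refine ⟨isUnder_left hd.1 (by simp; linarith), List.isChain_cons_cons.2 ⟨?_,
              List.isChain_cons_cons.2 ⟨?_, isUnder_right h3 (by simp; linarith)⟩⟩⟩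
            · intro _ _
              simp only [signedArea] at hxs ⊢
              nlinarith
            · intro _ _
              simp only [signedArea] at hxs ⊢
              nlinarith
          · have h := hunder s hs
            obtain ⟨h1, h2⟩ := IsUnder.insert (List.isChain_cons_cons.1 h.2).1 hxv hxw hxs
            exact h.insert h1 h2)
        hfirst (by simpa using hlast)
      exact ⟨_, hm.insert hxf (card_triple hxv hxw) hP⟩

end Sweep

section Subdivision

open Geometry AffineMap

variable {E : Type*} [AddCommGroup E] [Module ℝ E] {Δ Δ' : SimplicialComplex ℝ E}

theorem isExtreme_convexHull_of_subset {J H : Finset E} (hH : AffineIndependent ℝ ((↑) : H → E))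
    (hJ : J ⊆ H) : IsExtreme ℝ (convexHull ℝ (H : Set E)) (convexHull ℝ (J : Set E)) := by
  classical
  refine ⟨convexHull_mono (by exact_mod_cast hJ), ?_⟩
  intro x hx y hy z hz hseg
  obtain ⟨a, b, ha, hb, hab, rfl⟩ := hseg
  obtain ⟨wx, hx0, hx1, rfl⟩ := Finset.mem_convexHull'.1 hx
  obtain ⟨wy, hy0, hy1, rfl⟩ := Finset.mem_convexHull'.1 hy
  obtain ⟨w, hw0, hw1, hw⟩ := Finset.mem_convexHull'.1 hz
  have hzero := hH.eq_zero_of_sum_eq_zero_subtype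
    (w := fun i => a * wx i + b * wy i - if i ∈ J then w i else 0)
    (by
      rw [Finset.sum_sub_distrib, Finset.sum_add_distrib, ← Finset.mul_sum, ← Finset.mul_sum,
        hx1, hy1, ← Finset.sum_filter, Finset.filter_mem_eq_inter, Finset.inter_eq_right.2 hJ, hw1]
      linarith)
    (by
      simp only [sub_smul, add_smul, mul_smul, ite_smul, zero_smul]
      rw [Finset.sum_sub_distrib, Finset.sum_add_distrib, ← Finset.smul_sum, ← Finset.smul_sum,
        ← Finset.sum_filter, Finset.filter_mem_eq_inter, Finset.inter_eq_right.2 hJ, hw, sub_self])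
  have hout : ∀ i ∈ H, i ∉ J → wx i = 0 := by
    intro i hi hiJ
    have h := hzero i hi
    simp only [hiJ, if_false, sub_zero] at h
    have h1 := mul_nonneg ha.le (hx0 i hi)
    have h2 := mul_nonneg hb.le (hy0 i hi)
    have h3 : a * wx i = 0 := by linarith
    exact (mul_eq_zero.1 h3).resolve_left ha.ne'
  refine Finset.mem_convexHull'.2 ⟨wx, fun i hi => hx0 i (hJ hi), ?_, ?_⟩
  · rw [← hx1]
    exact Finset.sum_subset hJ hout
  · exact Finset.sum_subset hJ fun i hi hiJ => by rw [hout i hi hiJ, zero_smul]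

theorem IsExtreme.mem_of_sum_mem {A C : Set E} (hC : IsExtreme ℝ A C) (hA : Convex ℝ A)
    {G : Finset E} (hG : (G : Set E) ⊆ A) {w : E → ℝ} (hw : ∀ i ∈ G, 0 ≤ w i)
    (hw1 : ∑ i ∈ G, w i = 1) (hmem : ∑ i ∈ G, w i • i ∈ C) {g : E} (hg : g ∈ G) (hpos : 0 < w g) :
    g ∈ C := by
  classical
  rw [← Finset.add_sum_erase _ _ hg] at hw1 hmem
  have hw' : ∀ i ∈ G.erase g, 0 ≤ w i := fun i hi => hw i (Finset.mem_of_mem_erase hi)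
  rcases (Finset.sum_nonneg hw').eq_or_lt with h | h
  · have h0 := (Finset.sum_eq_zero_iff_of_nonneg hw').1 h.symm
    rw [Finset.sum_eq_zero fun i hi => by rw [h0 i hi, zero_smul], add_zero,
      show w g = 1 by linarith, one_smul] at hmem
    exact hmem
  · set c := ∑ i ∈ G.erase g, w i
    refine hC.2 (hG hg) (y := c⁻¹ • ∑ i ∈ G.erase g, w i • i) ?_ hmem
      ⟨w g, c, hpos, h, hw1, by rw [smul_inv_smul₀ h.ne']⟩
    rw [Finset.smul_sum]
    simp only [smul_smul]
    refine hA.sum_mem (fun i hi => mul_nonneg (inv_nonneg.2 h.le) (hw' i hi)) ?_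
      fun i hi => hG (Finset.mem_of_mem_erase hi)
    rw [← Finset.mul_sum, inv_mul_cancel₀ h.ne']

/-- Every simplex of the complex `Δ` is a union of simplices of its subdivision `Δ'`. -/
theorem exists_face_of_mem_convexHull (hspace : Δ'.space = Δ.space)
    (hsub : ∀ G ∈ Δ'.faces, ∃ F ∈ Δ.faces, convexHull ℝ (G : Set E) ⊆ convexHull ℝ (F : Set E))
    {F : Finset E} (hF : F ∈ Δ.faces) {q : E} (hq : q ∈ convexHull ℝ (F : Set E)) :
    ∃ G ∈ Δ'.faces, convexHull ℝ (G : Set E) ⊆ convexHull ℝ (F : Set E) ∧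
      q ∈ convexHull ℝ (G : Set E) := by
  classical
  obtain ⟨G, hG, hqG⟩ := SimplicialComplex.mem_space_iff.1
    (hspace ▸ SimplicialComplex.convexHull_subset_space hF hq : q ∈ Δ'.space)
  obtain ⟨H, hH, hGH⟩ := hsub G hG
  obtain ⟨w, hw, hw1, rfl⟩ := Finset.mem_convexHull'.1 hqG
  have hqJ := Δ.inter_subset_convexHull hF hH ⟨hq, hGH hqG⟩
  rw [← Finset.coe_inter] at hqJ
  have hext := isExtreme_convexHull_of_subset (Δ.indep hH) (Finset.inter_subset_right (s₁ := F))
  have hout : ∀ i ∈ G, i ∉ G.filter (0 < w ·) → w i = 0 := by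
    intro i hi hi'
    simp only [Finset.mem_filter, not_and, not_lt] at hi'
    exact le_antisymm (hi' hi) (hw i hi)
  have hsum := Finset.sum_subset (Finset.filter_subset _ _) hout
  have hne : (G.filter (0 < w ·)).Nonempty := by
    by_contra h
    rw [Finset.not_nonempty_iff_eq_empty] at h
    rw [h, hw1] at hsum
    simp at hsum
  refine ⟨G.filter (0 < w ·), Δ'.down_closed hG (Finset.filter_subset _ _) hne, ?_, ?_⟩
  · refine convexHull_min (fun g hg => ?_) (convex_convexHull ℝ _)
    simp only [Finset.coe_filter, Set.mem_ofPred_eq] at hg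
    have := hext.mem_of_sum_mem (convex_convexHull ℝ _)
      ((subset_convexHull ℝ _).trans hGH) hw hw1 hqJ hg.1 hg.2
    exact convexHull_mono (by simp) this
  · refine Finset.mem_convexHull'.2 ⟨w, fun i hi => hw i (Finset.mem_filter.1 hi).1, ?_, ?_⟩
    · rw [hsum, hw1]
    · exact Finset.sum_subset (Finset.filter_subset _ _) fun i hi hi' => by
        rw [hout i hi hi', zero_smul]

theorem vertices_subset_of_subdivision (hspace : Δ'.space = Δ.space)
    (hsub : ∀ G ∈ Δ'.faces, ∃ F ∈ Δ.faces, convexHull ℝ (G : Set E) ⊆ convexHull ℝ (F : Set E)) :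
    Δ.vertices ⊆ Δ'.vertices := by
  intro P hP
  obtain ⟨G, hG, hGP, hPG⟩ := exists_face_of_mem_convexHull hspace hsub hP (q := P) (by simp)
  obtain ⟨g, hg⟩ := SimplicialComplex.nonempty_of_mem_faces hG
  have := hGP (subset_convexHull ℝ _ hg)
  rw [Finset.coe_singleton, convexHull_singleton, Set.mem_singleton_iff] at this
  exact Δ'.down_closed hG (by simpa [← this] using hg) (by simp)

theorem isChain_consecutive {l : List ℝ} (hl : l.Pairwise (· < ·)) :
    l.IsChain fun u w => u < w ∧ ∀ t ∈ l, t ≤ u ∨ w ≤ t := by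
  rw [List.isChain_iff_getElem]
  rw [List.pairwise_iff_getElem] at hl
  intro i hi
  refine ⟨hl _ _ _ _ (by omega), fun t ht => ?_⟩
  obtain ⟨j, hj, rfl⟩ := List.getElem_of_mem ht
  rcases lt_trichotomy j i with h | rfl | h
  · exact .inl (hl _ _ _ _ h).le
  · exact .inl le_rfl
  · rcases (show i + 1 ≤ j from h).eq_or_lt with rfl | h
    · exact .inr le_rfl
    · exact .inr (hl _ _ _ _ h).le

/-- The list `l` consists of the parameters of the inner vertices of the subdivided edge `P Q`. -/
structure IsEdgePath [DecidableEq E] (Δ' : SimplicialComplex ℝ E) (P Q : E) (l : List ℝ) :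
    Prop where
  pairwise : (0 :: l ++ [1]).Pairwise (· < ·)
  mem : ∀ t ∈ Set.Icc (0 : ℝ) 1, lineMap P Q t ∈ Δ'.vertices → t ∈ 0 :: l ++ [1]
  chain : (0 :: l ++ [1]).IsChain fun u w => {lineMap P Q u, lineMap P Q w} ∈ Δ'.faces

theorem IsEdgePath.pos_lt_one [DecidableEq E] {P Q : E} {l : List ℝ} (h : IsEdgePath Δ' P Q l)
    {t : ℝ} (ht : t ∈ l) : 0 < t ∧ t < 1 := by
  have := h.pairwise
  rw [List.cons_append, List.pairwise_cons, List.pairwise_append] at this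
  exact ⟨this.1 t (by simp [ht]), this.2.2.2 t ht 1 (by simp)⟩

theorem IsEdgePath.reverse [DecidableEq E] {P Q : E} {l : List ℝ} (h : IsEdgePath Δ' P Q l) :
    IsEdgePath Δ' Q P (l.reverse.map (1 - ·)) := by
  have hl : 0 :: l.reverse.map (1 - ·) ++ [1] = ((0 :: l ++ [1]).map ((1 : ℝ) - ·)).reverse := by
    simp [← List.map_reverse]
  refine ⟨?_, ?_, ?_⟩
  · rw [hl, List.pairwise_reverse, List.pairwise_map]
    exact h.pairwise.imp fun h => by linarith
  · intro t ht hv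
    rw [hl, List.mem_reverse, List.mem_map]
    exact ⟨1 - t, h.mem _ ⟨by linarith [ht.2], by linarith [ht.1]⟩
      (by rwa [lineMap_apply_one_sub]), by ring⟩
  · rw [hl, List.isChain_reverse, List.isChain_map]
    refine h.chain.imp fun u w h => ?_
    simp only [lineMap_apply_one_sub]
    rwa [Finset.pair_comm]

theorem exists_isEdgePath [DecidableEq E] (hspace : Δ'.space = Δ.space)
    (hsub : ∀ G ∈ Δ'.faces, ∃ F ∈ Δ.faces, convexHull ℝ (G : Set E) ⊆ convexHull ℝ (F : Set E))
    (hfin : Δ'.faces.Finite) {P Q : E} (hPQ : P ≠ Q) (hF : {P, Q} ∈ Δ.faces) :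
    ∃ l, IsEdgePath Δ' P Q l := by
  have hinj : Function.Injective (lineMap P Q : ℝ → E) := lineMap_injective ℝ hPQ
  have hvfin : Δ'.vertices.Finite :=
    hfin.preimage (f := fun x => ({x} : Finset E)) (Finset.singleton_injective.injOn)
  have hTfin : {t : ℝ | (0 < t ∧ t < 1) ∧ lineMap P Q t ∈ Δ'.vertices}.Finite :=
    (hvfin.preimage hinj.injOn).subset fun t ht => ht.2
  set l := hTfin.toFinset.sort (· ≤ ·) with hl
  have hmem : ∀ t, t ∈ l ↔ (0 < t ∧ t < 1) ∧ lineMap P Q t ∈ Δ'.vertices := by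
    intro t
    simp [hl]
  have hPv : P ∈ Δ'.vertices := vertices_subset_of_subdivision hspace hsub
    (Δ.down_closed hF (by simp) (by simp))
  have hQv : Q ∈ Δ'.vertices := vertices_subset_of_subdivision hspace hsub
    (Δ.down_closed hF (by simp) (by simp))
  have hmem' : ∀ t, t ∈ 0 :: l ++ [1] ↔ t ∈ Set.Icc (0 : ℝ) 1 ∧ lineMap P Q t ∈ Δ'.vertices := by
    intro t
    simp only [List.cons_append, List.mem_cons, List.mem_append, hmem, List.not_mem_nil, or_false]
    constructor
    · rintro (rfl | h | rfl)
      · simpa using hPv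
      · exact ⟨⟨h.1.1.le, h.1.2.le⟩, h.2⟩
      · simpa using hQv
    · rintro ⟨⟨h0, h1⟩, hv⟩
      rcases h0.eq_or_lt with h | h
      · exact .inl h.symm
      · rcases h1.eq_or_lt with h' | h'
        · exact .inr (.inr h')
        · exact .inr (.inl ⟨⟨h, h'⟩, hv⟩)
  have hpair : (0 :: l ++ [1]).Pairwise (· < ·) := by
    rw [List.cons_append, List.pairwise_cons, List.pairwise_append]
    refine ⟨?_, (Finset.sortedLT_sort _).pairwise, by simp, ?_⟩
    · intro t ht
      rcases List.mem_append.1 ht with ht | ht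
      · exact ((hmem t).1 ht).1.1
      · rw [List.mem_singleton.1 ht]; norm_num
    · intro t ht s hs
      rw [List.mem_singleton.1 hs]
      exact ((hmem t).1 ht).1.2
  refine ⟨l, hpair, fun t h1 h2 => (hmem' t).2 ⟨h1, h2⟩, ?_⟩
  refine (isChain_consecutive hpair).imp_of_mem_imp ?_
  rintro u w hu hw ⟨huw, hcons⟩
  have hu' := (hmem' u).1 hu
  have hw' := (hmem' w).1 hw
  have hseg : convexHull ℝ (({P, Q} : Finset E) : Set E) = lineMap P Q '' Set.Icc (0 : ℝ) 1 := by
    rw [Finset.coe_pair, convexHull_pair, segment_eq_image_lineMap]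
  have hmid : lineMap P Q ((u + w) / 2) ∈ convexHull ℝ (({P, Q} : Finset E) : Set E) := by
    rw [hseg]
    exact ⟨_, ⟨by linarith [hu'.1.1, hw'.1.1], by linarith [hu'.1.2, hw'.1.2]⟩, rfl⟩
  obtain ⟨G, hG, hGs, hmG⟩ := exists_face_of_mem_convexHull hspace hsub hF hmid
  have hGt : ∀ g ∈ G, ∃ t ∈ 0 :: l ++ [1], lineMap P Q t = g := by
    intro g hg
    have h := hGs (subset_convexHull ℝ _ hg)
    rw [hseg] at h
    obtain ⟨t, ht, rfl⟩ := h
    exact ⟨t, (hmem' t).2 ⟨ht, Δ'.down_closed hG (by simpa using hg) (by simp)⟩, rfl⟩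
  have hconv : ∀ I : Set ℝ, Convex ℝ I → (∀ t, lineMap P Q t ∈ G → t ∈ I) →
      (u + w) / 2 ∈ I := by
    intro I hI h
    have : convexHull ℝ (G : Set E) ⊆ lineMap P Q '' I := by
      refine convexHull_min (fun g hg => ?_) (hI.affine_image _)
      obtain ⟨t, -, rfl⟩ := hGt g hg
      exact ⟨t, h t hg, rfl⟩
    obtain ⟨t, ht, h⟩ := this hmG
    rwa [← hinj h]
  have hle : ∃ a, a ≤ u ∧ lineMap P Q a ∈ G := by
    by_contra! hno
    have := hconv (Set.Ici w) (convex_Ici w) fun t ht => by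
      obtain ⟨t', ht', h⟩ := hGt _ ht
      rw [hinj h] at ht'
      exact (hcons t ht').resolve_left fun h => hno t h ht
    simp at this
    linarith
  have hge : ∃ b, w ≤ b ∧ lineMap P Q b ∈ G := by
    by_contra! hno
    have := hconv (Set.Iic u) (convex_Iic u) fun t ht => by
      obtain ⟨t', ht', h⟩ := hGt _ ht
      rw [hinj h] at ht'
      exact (hcons t ht').resolve_right fun h => hno t h ht
    simp at this
    linarith
  obtain ⟨a, hau, haG⟩ := hle
  obtain ⟨b, hwb, hbG⟩ := hge
  have hab : {lineMap P Q a, lineMap P Q b} ∈ Δ'.faces :=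
    Δ'.down_closed hG (by simp [Finset.insert_subset_iff, haG, hbG]) (by simp)
  have hin : ∀ t, a ≤ t → t ≤ b →
      lineMap P Q t ∈ convexHull ℝ (({lineMap P Q a, lineMap P Q b} : Finset E) : Set E) := by
    intro t hat htb
    rw [Finset.coe_pair, ← Set.image_pair, ← AffineMap.image_convexHull, convexHull_pair,
      segment_eq_Icc (hat.trans htb)]
    exact ⟨t, ⟨hat, htb⟩, rfl⟩
  have h1 := (SimplicialComplex.vertex_mem_convexHull_iff hu'.2 hab).1 (hin u hau (by linarith))
  have h2 := (SimplicialComplex.vertex_mem_convexHull_iff hw'.2 hab).1 (hin w (by linarith) hwb)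
  simp only [Finset.mem_insert, Finset.mem_singleton, hinj.eq_iff] at h1 h2
  have h3 : u = a := h1.resolve_right (by linarith)
  have h4 : w = b := h2.resolve_left (by linarith)
  rwa [h3, h4]

end Subdivision

section Chart

open Geometry AffineMap

variable {E : Type*} [AddCommGroup E] [Module ℝ E]

/-- The part inside `U` of the preimage of a simplicial complex under an injective affine map. -/
def pullbackComplex (Δ : SimplicialComplex ℝ E) (S : ℝ × ℝ →ᵃ[ℝ] E) (hS : Function.Injective S)
    (U : Set (ℝ × ℝ)) : SimplicialComplex ℝ (ℝ × ℝ) where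
  faces := {F | F.map ⟨S, hS⟩ ∈ Δ.faces ∧ (F : Set (ℝ × ℝ)) ⊆ U}
  isRelLowerSet_faces := fun F hF =>
    ⟨by simpa using SimplicialComplex.nonempty_of_mem_faces hF.1, fun G hGF hG =>
      ⟨Δ.down_closed hF.1 (Finset.map_subset_map.2 hGF) (by simpa using hG),
        fun x hx => hF.2 (hGF hx)⟩⟩
  indep := fun {F} hF => by
    refine AffineIndependent.of_comp S ?_
    exact (Δ.indep hF.1).comp_embedding
      ⟨fun x : F => ⟨S x, Finset.mem_map_of_mem ⟨S, hS⟩ x.2⟩, fun x y h =>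
        Subtype.ext (hS (Subtype.ext_iff.1 h))⟩
  inter_subset_convexHull := fun {s t} hs ht q hq => by
    have h : S q ∈ _ := Δ.inter_subset_convexHull hs.1 ht.1 ⟨by
        rw [Finset.coe_map]
        exact (S.image_convexHull _).subset ⟨q, hq.1, rfl⟩, by
        rw [Finset.coe_map]
        exact (S.image_convexHull _).subset ⟨q, hq.2, rfl⟩⟩
    rw [Finset.coe_map, Finset.coe_map, Function.Embedding.coeFn_mk, ← Set.image_inter hS] at h
    obtain ⟨q', hq', h⟩ := (S.image_convexHull _).superset h
    rwa [← hS h]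

/-- The affine chart of a plane sending `(-1, 0)`, `(s, -1)` and `(1, 0)` to `A`, `B` and `C`. -/
noncomputable def triangleChart (A B C : E) (s : ℝ) : ℝ × ℝ →ᵃ[ℝ] E :=
  ((LinearMap.fst ℝ ℝ ℝ).smulRight ((1 / 2 : ℝ) • (C - A)) +
    (LinearMap.snd ℝ ℝ ℝ).smulRight
      ((1 / 2 : ℝ) • (A + C) + (s / 2) • (C - A) - B)).toAffineMap +
    AffineMap.const ℝ _ ((1 / 2 : ℝ) • (A + C))

theorem triangleChart_apply (A B C : E) (s : ℝ) (q : ℝ × ℝ) :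
    triangleChart A B C s q = ((1 + q.2 - q.1 - s * q.2) / 2) • A + (-q.2) • B +
      ((1 + q.2 + q.1 + s * q.2) / 2) • C := by
  simp [triangleChart]
  module

theorem triangleChart_shear (A B C : E) (s : ℝ) (q : ℝ × ℝ) :
    triangleChart A B C 0 q = triangleChart A B C s (q.1 - s * q.2, q.2) := by
  simp only [triangleChart_apply]
  module

/-- The triangle with vertices `(-1, 0)`, `(s, -1)` and `(1, 0)`. -/
def chartTriangle (s : ℝ) : Set (ℝ × ℝ) :=
  {q | q.2 ≤ 0 ∧ -(1 + q.2) ≤ q.1 + s * q.2 ∧ q.1 + s * q.2 ≤ 1 + q.2}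

theorem convex_chartTriangle (s : ℝ) : Convex ℝ (chartTriangle s) := by
  intro x hx y hy a b ha hb hab
  obtain rfl : b = 1 - a := by linarith
  simp only [chartTriangle, Set.mem_ofPred_eq, Prod.fst_add, Prod.snd_add, Prod.smul_fst,
    Prod.smul_snd, smul_eq_mul] at hx hy ⊢
  refine ⟨?_, ?_, ?_⟩
  · nlinarith [mul_le_mul_of_nonneg_left hx.1 ha, mul_le_mul_of_nonneg_left hy.1 hb]
  · nlinarith [mul_le_mul_of_nonneg_left hx.2.1 ha, mul_le_mul_of_nonneg_left hy.2.1 hb]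
  · nlinarith [mul_le_mul_of_nonneg_left hx.2.2 ha, mul_le_mul_of_nonneg_left hy.2.2 hb]

theorem convexHull_triple_eq_image (A B C : E) (s : ℝ) :
    convexHull ℝ {A, B, C} = triangleChart A B C s '' chartTriangle s := by
  have hA : triangleChart A B C s (-1, 0) = A := by rw [triangleChart_apply]; module
  have hB : triangleChart A B C s (s, -1) = B := by rw [triangleChart_apply]; module
  have hC : triangleChart A B C s (1, 0) = C := by rw [triangleChart_apply]; module
  apply Set.Subset.antisymm
  · refine convexHull_min ?_ ((convex_chartTriangle s).affine_image _)
    rintro x (rfl | rfl | rfl)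
    · exact ⟨(-1, 0), by simp [chartTriangle], hA⟩
    · exact ⟨(s, -1), by simp [chartTriangle], hB⟩
    · exact ⟨(1, 0), by simp [chartTriangle], hC⟩
  · rintro _ ⟨q, ⟨h1, h2, h3⟩, rfl⟩
    rw [triangleChart_apply]
    have hc := convex_convexHull ℝ ({A, B, C} : Set E)
    have := hc.sum_mem (t := Finset.univ)
      (w := ![(1 + q.2 - q.1 - s * q.2) / 2, -q.2, (1 + q.2 + q.1 + s * q.2) / 2])
      (z := ![A, B, C]) (by
        intro i _
        fin_cases i <;> simp <;> linarith) (by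
        simp [Fin.sum_univ_three]
        ring) (by
        intro i _
        apply subset_convexHull
        fin_cases i <;> simp)
    simpa [Fin.sum_univ_three] using this

theorem triangleChart_injective [DecidableEq E] {A B C : E}
    (h : AffineIndependent ℝ ((↑) : ({A, B, C} : Finset E) → E)) (hAB : A ≠ B) (hBC : B ≠ C)
    (hAC : A ≠ C) (s : ℝ) : Function.Injective (triangleChart A B C s) := by
  intro q q' heq
  rw [triangleChart_apply, triangleChart_apply, ← sub_eq_zero] at heq
  set y := q.2 - q'.2 with hy
  set x := q.1 - q'.1 with hx
  have key := h.eq_zero_of_sum_eq_zero_subtype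
    (w := fun i => if i = A then (y - x - s * y) / 2 else if i = B then -y else (y + x + s * y) / 2)
    (by
      rw [Finset.sum_insert (by simp [hAB, hAC]), Finset.sum_pair hBC]
      simp [hAB.symm, hBC.symm, hAC.symm]
      ring)
    (by
      rw [Finset.sum_insert (by simp [hAB, hAC]), Finset.sum_pair hBC]
      simp only [if_true, hAB.symm, hBC.symm, hAC.symm, if_false]
      rw [← heq, hx, hy]
      module)
  have h1 := key B (by simp)
  have h2 := key C (by simp)
  simp only [if_true, hAB.symm, hBC.symm, hAC.symm, if_false] at h1 h2
  have h3 : y = 0 := by linarith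
  rw [h3] at h2
  exact Prod.ext (by linarith) (by linarith)

theorem exists_injOn_shear {Z : Set (ℝ × ℝ)} (hZ : Z.Finite) :
    ∃ s : ℝ, -1 < s ∧ s < 1 ∧ Set.InjOn (fun q : ℝ × ℝ => q.1 - s * q.2) Z := by
  have hbad : ((fun p : (ℝ × ℝ) × (ℝ × ℝ) => (p.1.1 - p.2.1) / (p.1.2 - p.2.2)) ''
      (Z ×ˢ Z)).Finite := (hZ.prod hZ).image _
  obtain ⟨s, hs, hs'⟩ := ((Set.Ioo_infinite (by norm_num : (-1 : ℝ) < 1)).sdiff hbad).nonempty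
  refine ⟨s, hs.1, hs.2, fun q hq q' hq' h => ?_⟩
  simp only at h
  have hy : q.2 = q'.2 := by
    by_contra hne
    have hne' : q.2 - q'.2 ≠ 0 := sub_ne_zero.2 hne
    refine hs' ⟨(q, q'), ⟨hq, hq'⟩, ?_⟩
    simp only
    rw [div_eq_iff hne']
    linarith
  exact Prod.ext (by rw [hy] at h; linarith) hy

end Chart

section TriangleSweep

open Geometry AffineMap

variable {E : Type*} [AddCommGroup E] [Module ℝ E] [DecidableEq E] {Δ Δ' : SimplicialComplex ℝ E}

theorem triangleSet_map {α β : Type*} [DecidableEq α] [DecidableEq β] (g : α → β)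
    (τ : α × α × α) :
    triangleSet (Prod.map g (Prod.map g g) τ) = (triangleSet τ).image g := by
  simp [triangleSet, Finset.image_insert]

theorem insCount_map {α β : Type*} (g : α → β) (m : List (SweepMove α)) :
    insCount (m.map (Sum.map g id)) = insCount m := by
  simp only [insCount, List.countP_map]
  congr 1
  ext (_ | _) <;> rfl

theorem delCount_map {α β : Type*} (g : α → β) (m : List (SweepMove α)) :
    delCount (m.map (Sum.map g id)) = delCount m := by
  simp only [delCount, List.countP_map]
  congr 1
  ext (_ | _) <;> rfl

theorem skipCount_map {α β : Type*} (g : α → β) (m : List (SweepMove α)) :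
    skipCount (m.map (Sum.map g id)) = skipCount m := by
  simp only [skipCount, List.countP_map]
  congr 1
  ext (_ | _) <;> rfl

/-- A move sequence `m` sweeps the subdivided triangle `A B C`, starting with the subdivided edges
`A B` and `B C`. -/
structure IsTriangleSweep (Δ' : SimplicialComplex ℝ E) (A B C : E) (l₁ l₂ l₃ : List ℝ)
    (m : List (SweepMove E)) : Prop where
  nodup : ((sweptTriangles [A] (l₁.map (lineMap A B) ++ B :: l₂.map (lineMap B C) ++ [C]) m).map
    triangleSet).Nodup
  mem : ∀ s ∈ (sweptTriangles [A] (l₁.map (lineMap A B) ++ B :: l₂.map (lineMap B C) ++ [C]) m).map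
    triangleSet, s ∈ Δ'.faces ∧ s.card = 3 ∧ (s : Set E) ⊆ convexHull ℝ {A, B, C}
  length :
    (sweptTriangles [A] (l₁.map (lineMap A B) ++ B :: l₂.map (lineMap B C) ++ [C]) m).length =
      insCount m + delCount m
  skip : skipCount m = l₁.length + l₂.length + 2 + insCount m
  le_del : l₁.length + l₂.length + 1 ≤ delCount m
  ins_le : insCount m + l₁.length + l₂.length + 1 ≤ delCount m + l₃.length

theorem exists_isTriangleSweep (hspace : Δ'.space = Δ.space)
    (hsub : ∀ G ∈ Δ'.faces, ∃ F ∈ Δ.faces, convexHull ℝ (G : Set E) ⊆ convexHull ℝ (F : Set E))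
    (hfin : Δ'.faces.Finite) {A B C : E} (hAB : A ≠ B) (hBC : B ≠ C) (hAC : A ≠ C)
    (hF : {A, B, C} ∈ Δ.faces) {l₁ l₂ l₃ : List ℝ} (h1 : IsEdgePath Δ' A B l₁)
    (h2 : IsEdgePath Δ' B C l₂) (h3 : IsEdgePath Δ' A C l₃) :
    ∃ m, IsTriangleSweep Δ' A B C l₁ l₂ l₃ m := by
  have hinj := triangleChart_injective (Δ.indep hF) hAB hBC hAC
  have hvfin : Δ'.vertices.Finite :=
    hfin.preimage (f := fun x => ({x} : Finset E)) (Finset.singleton_injective.injOn)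
  obtain ⟨s, hs1, hs2, hs⟩ := exists_injOn_shear (hvfin.preimage (hinj 0).injOn)
  set S := triangleChart A B C s with hS
  have hSinj : Function.Injective S := hinj s
  have hA : S (-1, 0) = A := by rw [hS, triangleChart_apply]; module
  have hB : S (s, -1) = B := by rw [hS, triangleChart_apply]; module
  have hC : S (1, 0) = C := by rw [hS, triangleChart_apply]; module
  set D := pullbackComplex Δ' S hSinj (chartTriangle s) with hD
  have hhull : convexHull ℝ (({A, B, C} : Finset E) : Set E) = S '' chartTriangle s := by
    rw [← convexHull_triple_eq_image]
    simp
  have hDv : ∀ q, q ∈ D.vertices ↔ S q ∈ Δ'.vertices ∧ q ∈ chartTriangle s := by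
    intro q
    simp [SimplicialComplex.mem_vertices, hD, pullbackComplex]
  have hDspace : D.space = chartTriangle s := by
    apply Set.Subset.antisymm
    · intro q hq
      obtain ⟨F, hF, hq⟩ := SimplicialComplex.mem_space_iff.1 hq
      exact convexHull_min hF.2 (convex_chartTriangle s) hq
    · intro q hq
      obtain ⟨G, hG, hGF, hqG⟩ := exists_face_of_mem_convexHull hspace hsub hF (q := S q)
        (by rw [hhull]; exact ⟨q, hq, rfl⟩)
      have hG' : (G : Set E) ⊆ S '' chartTriangle s :=
        hhull ▸ (subset_convexHull ℝ _).trans hGF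
      obtain ⟨F, hFs, hFG⟩ := Finset.subset_set_image_iff.1 hG'
      have hFG' : F.map ⟨S, hSinj⟩ = G := by rw [Finset.map_eq_image]; exact hFG
      refine SimplicialComplex.mem_space_iff.2 ⟨F, ⟨hFG' ▸ hG, hFs⟩, ?_⟩
      rw [← hFG', Finset.coe_map, Function.Embedding.coeFn_mk, ← S.image_convexHull] at hqG
      obtain ⟨q', hq', h⟩ := hqG
      rwa [← hSinj h]
  have hDfin : D.faces.Finite :=
    (hfin.preimage (f := fun F : Finset (ℝ × ℝ) => F.map ⟨S, hSinj⟩)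
      (Finset.map_injective _).injOn).subset
      fun F hF => hF.1
  have hpair : ∀ {q q' : ℝ × ℝ}, q ∈ chartTriangle s → q' ∈ chartTriangle s →
      {S q, S q'} ∈ Δ'.faces → {q, q'} ∈ D.faces := by
    intro q q' hq hq' h
    refine ⟨by simpa [Finset.map_insert] using h, ?_⟩
    rw [Finset.coe_pair]
    exact Set.pair_subset hq hq'
  have hbox : ∀ q ∈ D.space, -1 ≤ q.1 ∧ q.1 ≤ 1 ∧ q.2 ≤ 0 := by
    intro q hq
    rw [hDspace] at hq
    obtain ⟨h0, h1, h2⟩ := hq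
    exact ⟨by nlinarith, by nlinarith, h0⟩
  have hup : ∀ q ∈ D.space, ∀ y, q.2 ≤ y → y ≤ 0 → (q.1, y) ∈ D.space := by
    intro q hq y hqy hy
    rw [hDspace] at hq ⊢
    obtain ⟨h0, h1, h2⟩ := hq
    exact ⟨hy, by simp only; nlinarith, by simp only; nlinarith⟩
  have hDinj : Set.InjOn Prod.fst D.vertices := by
    intro q hq q' hq' h
    have hq := ((hDv q).1 hq).1
    have hq' := ((hDv q').1 hq').1
    have hsh : ∀ q : ℝ × ℝ, triangleChart A B C 0 (q.1 + s * q.2, q.2) = S q := by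
      intro q
      rw [triangleChart_shear A B C s]
      simp [hS]
    have := hs (x₁ := (q.1 + s * q.2, q.2)) (by simpa [hsh] using hq)
      (x₂ := (q'.1 + s * q'.2, q'.2)) (by simpa [hsh] using hq') (by simpa using h)
    simp only [Prod.mk.injEq] at this
    exact Prod.ext h this.2
  have hcA : ((-1, 0) : ℝ × ℝ) ∈ chartTriangle s := by simp [chartTriangle]
  have hcB : ((s, -1) : ℝ × ℝ) ∈ chartTriangle s := by simp [chartTriangle]
  have hcC : ((1, 0) : ℝ × ℝ) ∈ chartTriangle s := by simp [chartTriangle]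
  have hpath : ∀ {X Y : ℝ × ℝ} {P Q : E} {l : List ℝ}, X ∈ chartTriangle s →
      Y ∈ chartTriangle s → X.1 < Y.1 → S X = P → S Y = Q → IsEdgePath Δ' P Q l →
      (X :: l.map (lineMap X Y) ++ [Y]).IsChain (FrontEdge D) := by
    rintro X Y _ _ l hX hY hlt rfl rfl h
    have hl : X :: l.map (lineMap X Y) ++ [Y] = (0 :: l ++ [1]).map (lineMap X Y) := by simp
    rw [hl, List.isChain_map]
    have hmem : ∀ t ∈ 0 :: l ++ [1], (0 : ℝ) ≤ t ∧ t ≤ 1 := by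
      intro t ht
      simp only [List.cons_append, List.mem_cons, List.mem_append, List.not_mem_nil,
        or_false] at ht
      rcases ht with rfl | ht | rfl
      · simp
      · exact ⟨(h.pos_lt_one ht).1.le, (h.pos_lt_one ht).2.le⟩
      · simp
    have hin : ∀ t ∈ 0 :: l ++ [1], lineMap X Y t ∈ chartTriangle s := fun t ht =>
      (convex_chartTriangle s).lineMap_mem hX hY (hmem t ht)
    have hand : (0 :: l ++ [1]).IsChain fun u w =>
        u < w ∧ {lineMap (S X) (S Y) u, lineMap (S X) (S Y) w} ∈ Δ'.faces :=
      List.isChain_iff_getElem.2 fun i hi => ⟨List.isChain_iff_getElem.1 h.pairwise.isChain i hi,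
        List.isChain_iff_getElem.1 h.chain i hi⟩
    refine hand.imp_of_mem_imp fun u w hu hw huw => ⟨?_, ?_⟩
    · simp only [lineMap_apply, vsub_eq_sub, vadd_eq_add, Prod.fst_add, Prod.smul_fst,
        Prod.fst_sub, smul_eq_mul]
      nlinarith [huw.1]
    · refine hpair (hin u hu) (hin w hw) ?_
      rw [apply_lineMap, apply_lineMap]
      exact huw.2
  set r : List (ℝ × ℝ) := l₁.map (lineMap (-1, 0) (s, -1)) ++
    (s, -1) :: l₂.map (lineMap (s, -1) (1, 0)) ++ [(1, 0)] with hr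
  have hvert : ∀ {X : ℝ × ℝ}, X ∈ chartTriangle s → S X ∈ Δ.vertices → X ∈ D.vertices :=
    fun hX h => (hDv _).2 ⟨vertices_subset_of_subdivision hspace hsub h, hX⟩
  have hchain : ((-1, 0) :: r).IsChain (FrontEdge D) := by
    have h := List.isChain_split.2 ⟨hpath hcA hcB hs1 hA hB h1, hpath hcB hcC hs2 hB hC h2⟩
    simpa [hr] using h
  obtain ⟨m, hm⟩ := exists_isSweep hDfin hbox hup hDinj _ r (-1, 0) [] ∅ le_rfl
    (hvert hcA (hA ▸ Δ.down_closed hF (by simp) (by simp))) ⟨by simp, hchain⟩ (by simp) (by simp)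
    (by simp) (by rw [hr, ← List.cons_append, List.getLast?_concat])
  have hstart : (l₁.map (lineMap A B) ++ B :: l₂.map (lineMap B C) ++ [C]) = r.map S := by
    simp [hr, hA, hB, hC, Function.comp_def, apply_lineMap]
  have hswept : sweptTriangles [A] (l₁.map (lineMap A B) ++ B :: l₂.map (lineMap B C) ++ [C])
      (m.map (Sum.map S id)) = (sweptTriangles [(-1, 0)] r m).map (Prod.map S (Prod.map S S)) := by
    rw [hstart, ← hA]
    exact sweptTriangles_map S m [(-1, 0)] r
  have hsets : ((sweptTriangles [(-1, 0)] r m).map (Prod.map S (Prod.map S S))).map triangleSet =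
      ((sweptTriangles [(-1, 0)] r m).map triangleSet).map (Finset.map ⟨S, hSinj⟩) := by
    simp [triangleSet_map, Finset.map_eq_image]
  have hzero₁ : (l₁.map (lineMap ((-1, 0) : ℝ × ℝ) (s, -1))).countP (fun q => q.2 = 0) = 0 := by
    rw [List.countP_eq_zero]
    intro q hq
    obtain ⟨t, ht, rfl⟩ := List.mem_map.1 hq
    simp [lineMap_apply, (h1.pos_lt_one ht).1.ne']
  have hzero₂ : (l₂.map (lineMap ((s, -1) : ℝ × ℝ) (1, 0))).countP (fun q => q.2 = 0) = 0 := by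
    rw [List.countP_eq_zero]
    intro q hq
    obtain ⟨t, ht, rfl⟩ := List.mem_map.1 hq
    have := (h2.pos_lt_one ht).2
    simp [lineMap_apply]
    intro h
    linarith
  obtain ⟨f, hfn, hfv, hflen, hfle⟩ := hm.final
  have hf3 : f.length ≤ l₃.length + 2 := by
    have hsubp : (f.map fun q => (q.1 + 1) / 2).Subperm (0 :: l₃ ++ [1]) := by
      refine List.Nodup.subperm ?_ ?_
      · refine List.Nodup.map_on (fun q hq q' hq' h => ?_) hfn
        exact Prod.ext (by linarith) (by rw [(hfv q hq).2, (hfv q' hq').2])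
      · intro t ht
        obtain ⟨q, hq, rfl⟩ := List.mem_map.1 ht
        have hq0 := (hfv q hq).2
        have hv := (hDv q).1 (hfv q hq).1
        have hb := hbox q (by rw [hDspace]; exact hv.2)
        refine h3.mem _ ⟨by linarith, by linarith⟩ ?_
        convert hv.1 using 1
        rw [hS, triangleChart_apply, hq0, lineMap_apply_module]
        module
    simpa using hsubp.length_le
  have hrlen : r.length = l₁.length + l₂.length + 2 := by
    simp [hr]
    omega
  simp only [hr, List.countP_append, List.countP_cons, hzero₁, hzero₂] at hfle
  rw [hrlen] at hflen
  simp at hfle hflen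
  refine ⟨m.map (Sum.map S id), ?_, ?_, ?_, ?_, ?_, ?_⟩
  · rw [hswept, hsets]
    exact hm.nodup.map (Finset.map_injective _)
  · rw [hswept, hsets]
    intro t' ht'
    obtain ⟨t, ht, rfl⟩ := List.mem_map.1 ht'
    have := hm.mem t ht
    refine ⟨this.1.1, by rw [Finset.card_map, this.2.1], ?_⟩
    rw [Finset.coe_map, Function.Embedding.coeFn_mk, convexHull_triple_eq_image A B C s]
    exact Set.image_mono this.1.2
  · rw [hswept, List.length_map, hm.length, insCount_map, delCount_map]
  · rw [skipCount_map, insCount_map, hm.skip, hrlen]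
  · rw [delCount_map]
    omega
  · rw [delCount_map, insCount_map]
    omega

end TriangleSweep

section Indices

/-- The edges of the complete complex on eight vertices. -/
abbrev EdgeIndex := {e : Fin 8 × Fin 8 // e.1 < e.2}

/-- The triangles of the complete complex on eight vertices. -/
abbrev TriangleIndex := {τ : Fin 8 × Fin 8 × Fin 8 // τ.1 < τ.2.1 ∧ τ.2.1 < τ.2.2}

namespace TriangleIndex

/-- The position of the apex of a triangle. -/
def apexPosition (τ : TriangleIndex) : ℕ := (τ.1.1.val + τ.1.2.1.val + τ.1.2.2.val) % 3

/-- The smaller endpoint of the side opposite to the apex. -/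
def left (τ : TriangleIndex) : Fin 8 := if τ.apexPosition = 0 then τ.1.2.1 else τ.1.1

/-- The apex of a triangle. The three positions are balanced in such a way that each edge is
opposite to the apex in exactly two triangles. -/
def apex (τ : TriangleIndex) : Fin 8 :=
  if τ.apexPosition = 0 then τ.1.1 else if τ.apexPosition = 1 then τ.1.2.1 else τ.1.2.2

/-- The larger endpoint of the side opposite to the apex. -/
def right (τ : TriangleIndex) : Fin 8 :=
  if τ.apexPosition = 0 ∨ τ.apexPosition = 1 then τ.1.2.2 else τ.1.2.1

/-- The vertex set of a triangle. -/
def support (τ : TriangleIndex) : Finset (Fin 8) := {τ.left, τ.apex, τ.right}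

theorem left_lt_right (τ : TriangleIndex) : τ.left < τ.right := by
  obtain ⟨⟨x, y, z⟩, h1, h2⟩ := τ
  simp only [left, right]
  split_ifs <;> first | exact h1 | exact h2 | exact h1.trans h2 | omega

theorem left_ne_apex (τ : TriangleIndex) : τ.left ≠ τ.apex := by
  obtain ⟨⟨x, y, z⟩, h1, h2⟩ := τ
  simp only [left, apex]
  split_ifs <;> first | exact h1.ne' | exact h1.ne | exact (h1.trans h2).ne

theorem apex_ne_right (τ : TriangleIndex) : τ.apex ≠ τ.right := by
  obtain ⟨⟨x, y, z⟩, h1, h2⟩ := τ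
  simp only [right, apex]
  split_ifs <;> first | exact h2.ne | exact h2.ne' | exact (h1.trans h2).ne | omega

theorem support_eq (τ : TriangleIndex) : τ.support = {τ.1.1, τ.1.2.1, τ.1.2.2} := by
  obtain ⟨⟨x, y, z⟩, h1, h2⟩ := τ
  have h3 : apexPosition ⟨⟨x, y, z⟩, h1, h2⟩ < 3 := Nat.mod_lt _ (by norm_num)
  simp only [support, left, apex, right]
  ext i
  split_ifs <;> simp only [Finset.mem_insert, Finset.mem_singleton] <;> tauto

theorem card_support (τ : TriangleIndex) : τ.support.card = 3 :=
  Finset.card_eq_three.2 ⟨_, _, _, τ.left_ne_apex, τ.left_lt_right.ne, τ.apex_ne_right, rfl⟩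

theorem support_injective : Function.Injective support := by
  intro τ σ h
  rw [support_eq, support_eq] at h
  obtain ⟨⟨x, y, z⟩, h1, h2⟩ := τ
  obtain ⟨⟨x', y', z'⟩, h1', h2'⟩ := σ
  simp only [Finset.ext_iff, Finset.mem_insert, Finset.mem_singleton] at h h1 h2 h1' h2'
  have hx := h x
  have hy := h y
  have hz := h z
  have hx' := h x'
  have hy' := h y'
  have hz' := h z'
  simp only [Subtype.mk.injEq, Prod.mk.injEq]
  omega

theorem card_filter_top (e : EdgeIndex) :
    (Finset.univ.filter fun τ : TriangleIndex =>
      e.1 = (min τ.left τ.right, max τ.left τ.right)).card = 2 := by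
  revert e
  decide +kernel

theorem card_filter_bottom (e : EdgeIndex) :
    (Finset.univ.filter fun τ : TriangleIndex =>
      e.1 = (min τ.left τ.apex, max τ.left τ.apex)).card +
    (Finset.univ.filter fun τ : TriangleIndex =>
      e.1 = (min τ.apex τ.right, max τ.apex τ.right)).card = 4 := by
  revert e
  decide +kernel

theorem card_eq : Fintype.card TriangleIndex = 56 := by decide +kernel

end TriangleIndex

theorem EdgeIndex.card_eq : Fintype.card EdgeIndex = 28 := by decide +kernel

/-- The labels along the edge from `i` to `j`, where `a` lists the labels along each edge from its
smaller to its larger endpoint. -/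
def edgeLabels {α : Type*} (a : EdgeIndex → List α) (i j : Fin 8) : List α :=
  if h : i < j then a ⟨(i, j), h⟩ else if h : j < i then (a ⟨(j, i), h⟩).reverse else []

theorem length_edgeLabels {α : Type*} (a : EdgeIndex → List α) (i j : Fin 8) :
    (edgeLabels a i j).length =
      ∑ e : EdgeIndex, if e.1 = (min i j, max i j) then (a e).length else 0 := by
  rcases lt_trichotomy i j with h | rfl | h
  · rw [Finset.sum_eq_single_of_mem (⟨(i, j), h⟩ : EdgeIndex) (Finset.mem_univ _)]
    · simp [edgeLabels, h, h.le]
    · intro e _ he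
      rw [if_neg]
      rw [min_eq_left h.le, max_eq_right h.le]
      exact fun h' => he (Subtype.ext h')
  · rw [Finset.sum_eq_zero]
    · simp [edgeLabels]
    · intro e _
      rw [if_neg]
      intro h
      have := e.2
      simp [h] at this
  · rw [Finset.sum_eq_single_of_mem (⟨(j, i), h⟩ : EdgeIndex) (Finset.mem_univ _)]
    · simp [edgeLabels, h, h.le, h.not_gt]
    · intro e _ he
      rw [if_neg]
      rw [min_eq_right h.le, max_eq_left h.le]
      exact fun h' => he (Subtype.ext h')

theorem sum_length_edgeLabels {α : Type*} (a : EdgeIndex → List α)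
    (i j : TriangleIndex → Fin 8) :
    ∑ τ, (edgeLabels a (i τ) (j τ)).length = ∑ e, (Finset.univ.filter fun τ : TriangleIndex =>
      e.1 = (min (i τ) (j τ), max (i τ) (j τ))).card * (a e).length := by
  simp only [length_edgeLabels]
  rw [Finset.sum_comm]
  refine Finset.sum_congr rfl fun e _ => ?_
  rw [← Finset.sum_filter, Finset.sum_const, smul_eq_mul]

theorem sum_length_top {α : Type*} (a : EdgeIndex → List α) :
    ∑ τ : TriangleIndex, (edgeLabels a τ.left τ.right).length = 2 * ∑ e, (a e).length := by
  rw [sum_length_edgeLabels, Finset.mul_sum]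
  exact Finset.sum_congr rfl fun e _ => by rw [TriangleIndex.card_filter_top]

theorem sum_length_bottom {α : Type*} (a : EdgeIndex → List α) :
    ∑ τ : TriangleIndex, ((edgeLabels a τ.left τ.apex).length +
      (edgeLabels a τ.apex τ.right).length) = 4 * ∑ e, (a e).length := by
  rw [Finset.sum_add_distrib, sum_length_edgeLabels, sum_length_edgeLabels, Finset.mul_sum,
    ← Finset.sum_add_distrib]
  exact Finset.sum_congr rfl fun e _ => by rw [← add_mul, TriangleIndex.card_filter_bottom]

end Indices

section SweepData

open Geometry AffineMap

/-- Labels of the principal vertices and of the subdivided edges of the complete complex on eight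
vertices, together with a sweep of each triangle. -/
abbrev SweepData (α : Type*) :=
  (Fin 8 → α) × (EdgeIndex → List α) × (TriangleIndex → List (SweepMove α))

namespace SweepData

variable {α : Type*}

/-- The front at the start of the sweep of a triangle, without its first vertex. -/
def front (d : SweepData α) (τ : TriangleIndex) : List α :=
  edgeLabels d.2.1 τ.left τ.apex ++ d.1 τ.apex :: edgeLabels d.2.1 τ.apex τ.right ++ [d.1 τ.right]

/-- The triangles swept in the triangle `τ`. -/
def triangles [DecidableEq α] (d : SweepData α) (τ : TriangleIndex) : List (Finset α) :=
  (sweptTriangles [d.1 τ.left] (d.front τ) (d.2.2 τ)).map triangleSet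

/-- The properties of the sweeps of an embedded subdivision of the complete complex on eight
vertices. -/
structure IsValid [DecidableEq α] (d : SweepData α) : Prop where
  nodup : ∀ τ, (d.triangles τ).Nodup
  card : ∀ τ, ∀ s ∈ d.triangles τ, s.card = 3
  disjoint : ∀ τ σ, ∀ s ∈ d.triangles τ, s ∈ d.triangles σ → τ = σ
  length : ∀ τ, (d.triangles τ).length = insCount (d.2.2 τ) + delCount (d.2.2 τ)
  skip : ∀ τ, skipCount (d.2.2 τ) = (edgeLabels d.2.1 τ.left τ.apex).length +
    (edgeLabels d.2.1 τ.apex τ.right).length + 2 + insCount (d.2.2 τ)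
  le_del : ∀ τ, (edgeLabels d.2.1 τ.left τ.apex).length +
    (edgeLabels d.2.1 τ.apex τ.right).length + 1 ≤ delCount (d.2.2 τ)
  ins_le : ∀ τ, insCount (d.2.2 τ) + (edgeLabels d.2.1 τ.left τ.apex).length +
    (edgeLabels d.2.1 τ.apex τ.right).length + 1 ≤
      delCount (d.2.2 τ) + (edgeLabels d.2.1 τ.left τ.right).length

end SweepData

variable {E : Type*} [AddCommGroup E] [Module ℝ E] [DecidableEq E] {Δ Δ' : SimplicialComplex ℝ E}

theorem eq_of_subset_convexHull {s t G : Finset E} (hs : s ∈ Δ.faces) (ht : t ∈ Δ.faces)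
    (hst : s.card = t.card) (hG : AffineIndependent ℝ ((↑) : G → E)) (hGs : s.card ≤ G.card)
    (h1 : (G : Set E) ⊆ convexHull ℝ (s : Set E)) (h2 : (G : Set E) ⊆ convexHull ℝ (t : Set E)) :
    s = t := by
  have h : (G : Set E) ⊆ affineSpan ℝ ((s ∩ t : Finset E) : Set E) := by
    intro x hx
    rw [Finset.coe_inter]
    exact convexHull_subset_affineSpan _ (Δ.inter_subset_convexHull hs ht ⟨h1 hx, h2 hx⟩)
  have hcard := hG.card_le_card_of_subset_affineSpan h
  have h3 : s ∩ t = s := Finset.eq_of_subset_of_card_le Finset.inter_subset_left (by omega)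
  exact Finset.eq_of_subset_of_card_le (Finset.inter_eq_left.1 h3) hst.ge

theorem exists_sweepData {α : Type*} [DecidableEq α] (hspace : Δ'.space = Δ.space)
    (hsub : ∀ G ∈ Δ'.faces, ∃ F ∈ Δ.faces, convexHull ℝ (G : Set E) ⊆ convexHull ℝ (F : Set E))
    (hfin : Δ'.faces.Finite) {P : Fin 8 → E} (hP : Function.Injective P)
    (hfaces : ∀ s : Finset (Fin 8), s.Nonempty → s.card ≤ 3 → s.image P ∈ Δ.faces)
    {g : E → α} (hg : Set.InjOn g Δ'.vertices) :
    ∃ d : SweepData α, d.IsValid ∧ ∀ τ, ∀ s ∈ d.triangles τ, ∃ G ∈ Δ'.faces, G.image g = s := by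
  have hedge : ∀ e : EdgeIndex, ∃ l, IsEdgePath Δ' (P e.1.1) (P e.1.2) l := fun e =>
    exists_isEdgePath hspace hsub hfin (hP.ne e.2.ne) (by
      simpa [Finset.image_insert] using hfaces {e.1.1, e.1.2} (by simp)
        (Finset.card_le_two.trans (by norm_num)))
  choose l hl using hedge
  obtain ⟨p, hp⟩ : ∃ p : Fin 8 → Fin 8 → List ℝ, ∀ i j, i ≠ j → IsEdgePath Δ' (P i) (P j) (p i j) ∧
      edgeLabels (fun e => (l e).map fun t => g (lineMap (P e.1.1) (P e.1.2) t)) i j =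
        ((p i j).map (lineMap (P i) (P j))).map g := by
    refine ⟨fun i j => if h : i < j then l ⟨(i, j), h⟩ else if h : j < i then
      (l ⟨(j, i), h⟩).reverse.map (1 - ·) else [], fun i j hij => ?_⟩
    rcases hij.lt_or_gt with h | h
    · simp only [h, dif_pos, edgeLabels]
      exact ⟨hl ⟨(i, j), h⟩, by simp⟩
    · simp only [h, dif_pos, edgeLabels, h.not_gt, dif_neg, not_false_eq_true]
      refine ⟨(hl ⟨(j, i), h⟩).reverse, ?_⟩
      simp [Function.comp_def, lineMap_apply_one_sub]
  have hsupp : ∀ τ : TriangleIndex,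
      τ.support.image P = ({P τ.left, P τ.apex, P τ.right} : Finset E) := fun τ => by
    simp [TriangleIndex.support, Finset.image_insert]
  have hsuppf : ∀ τ : TriangleIndex, τ.support.image P ∈ Δ.faces := fun τ =>
    hfaces _ ⟨_, Finset.mem_insert_self _ _⟩ τ.card_support.le
  have hsweep : ∀ τ : TriangleIndex, ∃ m, IsTriangleSweep Δ' (P τ.left) (P τ.apex) (P τ.right)
      (p τ.left τ.apex) (p τ.apex τ.right) (p τ.left τ.right) m := fun τ =>
    exists_isTriangleSweep hspace hsub hfin (hP.ne τ.left_ne_apex) (hP.ne τ.apex_ne_right)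
      (hP.ne τ.left_lt_right.ne) (hsupp τ ▸ hsuppf τ) (hp _ _ τ.left_ne_apex).1
      (hp _ _ τ.apex_ne_right).1 (hp _ _ τ.left_lt_right.ne).1
  choose m hm using hsweep
  set d : SweepData α := (g ∘ P, fun e => (l e).map fun t => g (lineMap (P e.1.1) (P e.1.2) t),
    fun τ => (m τ).map (Sum.map g id)) with hd
  have hlen : ∀ i j, i ≠ j → (edgeLabels d.2.1 i j).length = (p i j).length := fun i j hij => by
    rw [hd]
    simp only
    rw [(hp i j hij).2, List.length_map, List.length_map]
  have hswept : ∀ τ, sweptTriangles [d.1 τ.left] (d.front τ) (d.2.2 τ) =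
      (sweptTriangles [P τ.left] ((p τ.left τ.apex).map (lineMap (P τ.left) (P τ.apex)) ++
        P τ.apex :: (p τ.apex τ.right).map (lineMap (P τ.apex) (P τ.right)) ++ [P τ.right])
          (m τ)).map (Prod.map g (Prod.map g g)) := by
    intro τ
    rw [← sweptTriangles_map]
    simp only [SweepData.front, hd, (hp _ _ τ.left_ne_apex).2, (hp _ _ τ.apex_ne_right).2]
    simp
  have htri : ∀ τ, d.triangles τ = ((sweptTriangles [P τ.left]
      ((p τ.left τ.apex).map (lineMap (P τ.left) (P τ.apex)) ++
        P τ.apex :: (p τ.apex τ.right).map (lineMap (P τ.apex) (P τ.right)) ++ [P τ.right])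
          (m τ)).map triangleSet).map (Finset.image g) := by
    intro τ
    rw [SweepData.triangles, hswept]
    simp [triangleSet_map]
  have hvert : ∀ G ∈ Δ'.faces, (G : Set E) ⊆ Δ'.vertices := fun G hG x hx =>
    Δ'.down_closed hG (by simpa using hx) (by simp)
  have hginj : ∀ G ∈ Δ'.faces, ∀ H ∈ Δ'.faces, G.image g = H.image g → G = H := by
    intro G hG H hH h
    have h' : g '' (G : Set E) = g '' (H : Set E) := by
      rw [← Finset.coe_image, ← Finset.coe_image, h]
    exact Finset.coe_injective ((hg.image_eq_image_iff (hvert G hG) (hvert H hH)).1 h')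
  refine ⟨d, ⟨?_, ?_, ?_, ?_, ?_, ?_, ?_⟩, ?_⟩
  · intro τ
    rw [htri]
    exact List.Nodup.map_on (fun G hG H hH h => hginj G ((hm τ).mem G hG).1 H ((hm τ).mem H hH).1 h)
      (hm τ).nodup
  · intro τ s hs
    rw [htri] at hs
    obtain ⟨G, hG, rfl⟩ := List.mem_map.1 hs
    have := (hm τ).mem G hG
    rw [Finset.card_image_of_injOn (hg.mono (hvert G this.1)), this.2.1]
  · intro τ σ s hs hs'
    rw [htri] at hs hs'
    obtain ⟨G, hG, rfl⟩ := List.mem_map.1 hs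
    obtain ⟨H, hH, h⟩ := List.mem_map.1 hs'
    have hGm := (hm τ).mem G hG
    have hHm := (hm σ).mem H hH
    obtain rfl := hginj H hHm.1 G hGm.1 h
    refine TriangleIndex.support_injective (Finset.image_injective hP ?_)
    refine eq_of_subset_convexHull (hsuppf τ) (hsuppf σ) ?_ (Δ'.indep hGm.1) ?_ ?_ ?_
    · rw [Finset.card_image_of_injective _ hP, Finset.card_image_of_injective _ hP,
        TriangleIndex.card_support, TriangleIndex.card_support]
    · rw [Finset.card_image_of_injective _ hP, TriangleIndex.card_support, hGm.2.1]
    · rw [hsupp]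
      simpa using hGm.2.2
    · rw [hsupp]
      simpa using hHm.2.2
  · intro τ
    rw [SweepData.triangles, hswept, List.length_map, List.length_map, (hm τ).length]
    simp [hd, insCount_map, delCount_map]
  · intro τ
    rw [hlen _ _ τ.left_ne_apex, hlen _ _ τ.apex_ne_right]
    simp [hd, skipCount_map, insCount_map, (hm τ).skip]
  · intro τ
    rw [hlen _ _ τ.left_ne_apex, hlen _ _ τ.apex_ne_right]
    simpa [hd, delCount_map] using (hm τ).le_del
  · intro τ
    rw [hlen _ _ τ.left_ne_apex, hlen _ _ τ.apex_ne_right, hlen _ _ τ.left_lt_right.ne]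
    simpa [hd, delCount_map, insCount_map] using (hm τ).ins_le
  · intro τ s hs
    rw [htri] at hs
    obtain ⟨G, hG, rfl⟩ := List.mem_map.1 hs
    exact ⟨G, ((hm τ).mem G hG).1, rfl⟩

end SweepData

theorem ContainsTopMinor.exists_sweepData {V : Type*} [Finite V] [DecidableEq V]
    {Y : Set (Finset V)} {t : ℕ} (ht : 8 ≤ t) (h : ContainsTopMinor Y (completeComplex t 2)) :
    ∃ d : SweepData V, d.IsValid ∧ ∀ τ, ∀ s ∈ d.triangles τ, s ∈ Y := by
  obtain ⟨K', f, ⟨m, Δ, Δ', φ, φ', ⟨hφ, hΔ⟩, ⟨hφ', hΔ'⟩, hspace, hsub⟩, hf, hY⟩ := h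
  let _ : DecidableEq (Fin m → ℝ) := Classical.decEq _
  set g : (Fin m → ℝ) → V := fun x => f (Function.invFunOn φ' (vertexSet K') x) with hgdef
  have hleft : ∀ v ∈ vertexSet K', Function.invFunOn φ' (vertexSet K') (φ' v) = v := fun v hv =>
    hφ'.leftInvOn_invFunOn hv
  have hvert : Δ'.vertices ⊆ φ' '' vertexSet K' := by
    intro x hx
    have hx' : {x} ∈ Δ'.faces := hx
    rw [hΔ'] at hx'
    obtain ⟨F, hF, -, hFx⟩ := hx'
    have hmem : x ∈ F.image φ' := hFx ▸ Finset.mem_singleton_self x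
    obtain ⟨v, hv, rfl⟩ := Finset.mem_image.1 hmem
    exact ⟨v, ⟨F, hF, hv⟩, rfl⟩
  have hg : Set.InjOn g Δ'.vertices := by
    intro x hx y hy hxy
    obtain ⟨v, hv, rfl⟩ := hvert hx
    obtain ⟨w, hw, rfl⟩ := hvert hy
    simp only [hgdef, hleft v hv, hleft w hw] at hxy
    rw [hf hv hw hxy]
  have hfin : Δ'.faces.Finite := by
    have hv : Δ'.vertices.Finite := Set.Finite.of_finite_image (Set.toFinite _) hg
    refine hv.toFinset.powerset.finite_toSet.subset fun G hG => ?_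
    simp only [Finset.mem_coe, Finset.mem_powerset]
    intro x hx
    exact hv.mem_toFinset.2 (Δ'.down_closed hG (by simpa using hx) (by simp))
  have hmem : ∀ i : Fin 8, (i : ℕ) ∈ vertexSet (completeComplex t 2) := fun i =>
    ⟨{(i : ℕ)}, ⟨by simpa using i.2.trans_le ht, by simp⟩, by simp⟩
  have hP : Function.Injective fun i : Fin 8 => φ i := fun i j hij =>
    Fin.ext (hφ (hmem i) (hmem j) hij)
  have hfaces : ∀ s : Finset (Fin 8), s.Nonempty → s.card ≤ 3 →
      s.image (fun i : Fin 8 => φ i) ∈ Δ.faces := by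
    intro s hs hcard
    rw [hΔ]
    refine ⟨s.image Fin.val, ⟨?_, Finset.card_image_le.trans hcard⟩, hs.image _, ?_⟩
    · intro i hi
      obtain ⟨j, -, rfl⟩ := Finset.mem_image.1 hi
      exact Finset.mem_range.2 (j.2.trans_le ht)
    · rw [Finset.image_image]
      rfl
  obtain ⟨d, hd, hd'⟩ := _root_.exists_sweepData hspace hsub hfin hP hfaces hg
  refine ⟨d, hd, fun τ s hs => ?_⟩
  obtain ⟨G, hG, rfl⟩ := hd' τ s hs
  rw [hΔ'] at hG
  obtain ⟨F, hF, -, rfl⟩ := hG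
  rw [Finset.image_image]
  convert hY F hF using 1
  exact Finset.image_congr fun v hv => congrArg f (hleft v ⟨F, hF, hv⟩)

section WeightedCounting

open ENNReal

theorem ENNReal.tsum_prod_pi_le {ι α : Type*} [Fintype ι] (g : α → ℝ≥0∞) :
    ∑' f : ι → α, ∏ i, g (f i) ≤ (∑' a, g a) ^ Fintype.card ι := by
  classical
  rw [ENNReal.tsum_eq_iSup_sum]
  refine iSup_le fun s => ?_
  calc ∑ f ∈ s, ∏ i, g (f i)
      ≤ ∑ f ∈ Fintype.piFinset fun i => s.image (· i), ∏ i, g (f i) :=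
        Finset.sum_le_sum_of_subset fun f hf =>
          Fintype.mem_piFinset.2 fun i => Finset.mem_image_of_mem _ hf
    _ = ∏ i, ∑ a ∈ s.image (· i), g a := (Finset.prod_univ_sum _ _).symm
    _ ≤ ∏ _i : ι, ∑' a, g a := Finset.prod_le_prod' fun i _ => ENNReal.sum_le_tsum _
    _ = (∑' a, g a) ^ Fintype.card ι := by simp

theorem ENNReal.tsum_list_prod_le_two {α : Type*} [Fintype α] {w : α → ℝ≥0∞}
    (hw : ∑ a, w a ≤ 2⁻¹) : ∑' l : List α, (l.map w).prod ≤ 2 := by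
  rw [← List.equivSigmaTuple.symm.tsum_eq, ENNReal.tsum_sigma']
  calc ∑' (k : ℕ) (f : Fin k → α), ((List.equivSigmaTuple.symm ⟨k, f⟩).map w).prod
      ≤ ∑' k : ℕ, (2⁻¹ : ℝ≥0∞) ^ k := by
        refine ENNReal.tsum_le_tsum fun k => ?_
        simp only [List.equivSigmaTuple, Equiv.coe_fn_symm_mk, List.map_ofFn, List.prod_ofFn,
          Function.comp_apply]
        refine (ENNReal.tsum_prod_pi_le w).trans ?_
        rw [tsum_fintype, Fintype.card_fin]
        gcongr
    _ = 2 := by simp [ENNReal.tsum_geometric]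

end WeightedCounting

section Weight

open ENNReal

/-- The weight of a move. -/
noncomputable def SweepMove.weight {α : Type*} (y : ℝ≥0∞) : SweepMove α → ℝ≥0∞ :=
  Sum.elim (fun _ => 6⁻¹ * y) fun _ => 6⁻¹

theorem SweepMove.prod_weight {α : Type*} (y : ℝ≥0∞) (m : List (SweepMove α)) :
    (m.map (SweepMove.weight y)).prod =
      6⁻¹ ^ (insCount m + delCount m + skipCount m) * y ^ insCount m := by
  induction m with
  | nil => simp [insCount, delCount, skipCount]
  | cons a m ih =>
    rw [List.map_cons, List.prod_cons, ih]
    rcases a with x | _ | _ <;>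
      simp [insCount, delCount, skipCount, SweepMove.weight, List.countP_cons] <;> ring

theorem SweepMove.sum_weight {α : Type*} [Fintype α] {y : ℝ≥0∞}
    (hy : (Fintype.card α : ℝ≥0∞) * y = 1) :
    ∑ a : SweepMove α, SweepMove.weight y a = 2⁻¹ := by
  have h6 : (6 : ℝ≥0∞)⁻¹ * (1 + 2) = 2⁻¹ := by
    rw [show (6 : ℝ≥0∞) = 2 * 3 by norm_num,
      ENNReal.mul_inv (Or.inl (by norm_num)) (Or.inl (by norm_num)), mul_assoc,
      show (1 + 2 : ℝ≥0∞) = 3 by norm_num,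
      ENNReal.inv_mul_cancel (by norm_num) (by norm_num), mul_one]
  rw [← h6, ← hy, mul_add]
  simp [SweepMove.weight]
  ring

namespace SweepData

variable {α : Type*}

/-- The weight of sweep data. -/
noncomputable def weight (y : ℝ≥0∞) (d : SweepData α) : ℝ≥0∞ :=
  y ^ 28 * ((∏ e, ((d.2.1 e).map fun _ => 6⁻¹ * y).prod) *
    ∏ τ, ((d.2.2 τ).map (SweepMove.weight y)).prod)

theorem tsum_weight_le [Fintype α] {y : ℝ≥0∞} (hy : (Fintype.card α : ℝ≥0∞) * y = 1)
    (hy1 : y ≤ 1) : ∑' d : SweepData α, d.weight y ≤ 2 ^ 84 * y := by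
  have hlabel : ∑ _a : α, (6⁻¹ * y : ℝ≥0∞) ≤ 2⁻¹ := by
    rw [Finset.sum_const, Finset.card_univ, nsmul_eq_mul, mul_left_comm, hy, mul_one]
    exact ENNReal.inv_le_inv.2 (by norm_num)
  have hedge : ∑' a : EdgeIndex → List α, ∏ e, ((a e).map fun _ => 6⁻¹ * y).prod ≤ 2 ^ 28 := by
    refine (ENNReal.tsum_prod_pi_le fun l : List α => (l.map fun _ => 6⁻¹ * y).prod).trans ?_
    rw [EdgeIndex.card_eq]
    gcongr
    exact ENNReal.tsum_list_prod_le_two hlabel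
  have htri : ∑' m : TriangleIndex → List (SweepMove α),
      ∏ τ, ((m τ).map (SweepMove.weight y)).prod ≤ 2 ^ 56 := by
    refine (ENNReal.tsum_prod_pi_le fun l : List (SweepMove α) =>
      (l.map (SweepMove.weight y)).prod).trans ?_
    rw [TriangleIndex.card_eq]
    gcongr
    exact ENNReal.tsum_list_prod_le_two (SweepMove.sum_weight hy).le
  simp only [weight, ENNReal.tsum_mul_left]
  rw [ENNReal.tsum_prod (f := fun (_ : Fin 8 → α)
      (q : (EdgeIndex → List α) × (TriangleIndex → List (SweepMove α))) =>
        (∏ e, ((q.1 e).map fun _ => 6⁻¹ * y).prod) * ∏ τ, ((q.2 τ).map (SweepMove.weight y)).prod),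
    ENNReal.tsum_prod (f := fun (a : EdgeIndex → List α)
      (m : TriangleIndex → List (SweepMove α)) =>
        (∏ e, ((a e).map fun _ => 6⁻¹ * y).prod) * ∏ τ, ((m τ).map (SweepMove.weight y)).prod)]
  simp only [ENNReal.tsum_mul_left, ENNReal.tsum_mul_right]
  rw [tsum_fintype (β := Fin 8 → α), Finset.sum_const, Finset.card_univ, Fintype.card_fun,
    Fintype.card_fin, nsmul_eq_mul]
  calc y ^ 28 * (_ * (((Fintype.card α ^ 8 : ℕ) : ℝ≥0∞) * _))
      ≤ y ^ 28 * (2 ^ 28 * (((Fintype.card α ^ 8 : ℕ) : ℝ≥0∞) * 2 ^ 56)) := by gcongr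
    _ = 2 ^ 84 * y * (((Fintype.card α : ℝ≥0∞) * y) ^ 8 * y ^ 19) := by push_cast; ring
    _ ≤ 2 ^ 84 * y * (1 ^ 8 * 1 ^ 19) := by rw [hy]; gcongr
    _ = 2 ^ 84 * y := by simp

variable [DecidableEq α]

/-- The set of all swept triangles. -/
def triangleFinset (d : SweepData α) : Finset (Finset α) :=
  Finset.univ.biUnion fun τ => (d.triangles τ).toFinset

theorem triangleFinset_subset_iff {d : SweepData α} {Y : Set (Finset α)} :
    ↑d.triangleFinset ⊆ Y ↔ ∀ τ, ∀ s ∈ d.triangles τ, s ∈ Y := by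
  simp only [triangleFinset, Set.subset_def, Finset.mem_coe, Finset.mem_biUnion, Finset.mem_univ,
    true_and, List.mem_toFinset, forall_exists_index]
  exact forall_comm

theorem IsValid.card_eq_three {d : SweepData α} (hd : d.IsValid) :
    ∀ s ∈ d.triangleFinset, s.card = 3 :=
  triangleFinset_subset_iff.2 hd.card

theorem IsValid.card_triangleFinset {d : SweepData α} (hd : d.IsValid) :
    d.triangleFinset.card = ∑ τ, (insCount (d.2.2 τ) + delCount (d.2.2 τ)) := by
  rw [triangleFinset, Finset.card_biUnion]
  · exact Finset.sum_congr rfl fun τ _ => by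
      rw [List.toFinset_card_of_nodup (hd.nodup τ), hd.length]
  · intro τ _ σ _ hne
    rw [Function.onFun, Finset.disjoint_left]
    intro s hs hs'
    exact hne (hd.disjoint τ σ s (List.mem_toFinset.1 hs) (List.mem_toFinset.1 hs'))

theorem IsValid.pow_card_le_weight {d : SweepData α} (hd : d.IsValid) {s : ℝ≥0∞} (hs : s ≤ 1) :
    (6⁻¹ ^ 4 * s) ^ d.triangleFinset.card ≤ d.weight (s ^ 2) := by
  have hI := Finset.sum_le_sum fun τ (_ : τ ∈ Finset.univ) => hd.ins_le τ
  have hD := Finset.sum_le_sum fun τ (_ : τ ∈ Finset.univ) => hd.le_del τ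
  have hS := Finset.sum_congr rfl fun τ (_ : τ ∈ Finset.univ) => hd.skip τ
  have hE := hd.card_triangleFinset
  have hT := sum_length_top d.2.1
  have hB := sum_length_bottom d.2.1
  simp only [Finset.sum_add_distrib, Finset.sum_const, Finset.card_univ, TriangleIndex.card_eq,
    smul_eq_mul] at hI hD hS hE hT hB
  have hw : d.weight (s ^ 2) =
      6⁻¹ ^ (∑ e, (d.2.1 e).length + (∑ τ, insCount (d.2.2 τ) + ∑ τ, delCount (d.2.2 τ) +
        ∑ τ, skipCount (d.2.2 τ))) *
      s ^ (2 * (28 + ∑ e, (d.2.1 e).length + ∑ τ, insCount (d.2.2 τ))) := by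
    simp only [weight, SweepMove.prod_weight, List.map_const', List.prod_replicate,
      Finset.prod_mul_distrib, Finset.prod_pow_eq_pow_sum, Finset.sum_add_distrib, mul_pow]
    ring
  rw [hw, mul_pow, ← pow_mul]
  have h6 : (6⁻¹ : ℝ≥0∞) ≤ 1 := ENNReal.inv_le_one.2 (by norm_num)
  exact mul_le_mul' (pow_le_pow_right_of_le_one' h6 (by omega))
    (pow_le_pow_right_of_le_one' hs (by omega))

end SweepData

end Weight

section Probability

open ENNReal

theorem bernoulliBool_true (p : ℝ) : bernoulliBool p {true} = ENNReal.ofReal p := by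
  simp [bernoulliBool]

theorem isProbabilityMeasure_bernoulliBool {p : ℝ} (h0 : 0 ≤ p) (h1 : p ≤ 1) :
    IsProbabilityMeasure (bernoulliBool p) := by
  constructor
  simp only [bernoulliBool, Measure.coe_add, Measure.coe_smul, Pi.add_apply, Pi.smul_apply,
    measure_univ, smul_eq_mul, mul_one]
  rw [← ENNReal.ofReal_add h0 (by linarith)]
  simp

theorem isProbabilityMeasure_complexMeasure (n k : ℕ) {p : ℝ} (h0 : 0 ≤ p) (h1 : p ≤ 1) :
    IsProbabilityMeasure (complexMeasure n k p) := by
  have := isProbabilityMeasure_bernoulliBool h0 h1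
  unfold complexMeasure
  infer_instance

theorem complexMeasure_subset_le {n k : ℕ} {p : ℝ} (h0 : 0 ≤ p) (h1 : p ≤ 1)
    {T : Finset (Finset (Fin n))} (hT : ∀ S ∈ T, S.card = k + 1) :
    complexMeasure n k p {ω | ↑T ⊆ sampleComplex n k ω} ≤ ENNReal.ofReal p ^ T.card := by
  have := isProbabilityMeasure_bernoulliBool h0 h1
  set A : {S : Finset (Fin n) // S.card = k + 1} → Set Bool :=
    fun S => if S.1 ∈ T then {true} else Set.univ with hA
  have hsub : {ω | ↑T ⊆ sampleComplex n k ω} ⊆ Set.univ.pi A := by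
    intro ω hω S _
    simp only [hA]
    split_ifs with hS
    · rcases hω hS with h | ⟨h, h'⟩
      · exact absurd h (by rw [S.2]; simp)
      · exact h'
    · trivial
  have hcard : (T.subtype fun S => S.card = k + 1).card = T.card := by
    rw [Finset.card_subtype, Finset.filter_true_of_mem hT]
  refine (measure_mono hsub).trans_eq ?_
  rw [complexMeasure, Measure.pi_pi, ← hcard, ← Finset.prod_const,
    ← Finset.prod_subset (Finset.subset_univ (T.subtype fun S => S.card = k + 1))]
  · refine Finset.prod_congr rfl fun S hS => ?_
    simp only [hA, if_pos (Finset.mem_subtype.1 hS), bernoulliBool_true]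
  · intro S _ hS
    simp only [hA, if_neg fun h => hS (Finset.mem_subtype.2 h), measure_univ]

theorem complexMeasure_containsTopMinor_le {n t : ℕ} (hn : 0 < n) (ht : 8 ≤ t) :
    complexMeasure n 2 (Real.sqrt ((1 / 6) ^ 8 / (n : ℝ)))
      {ω | ContainsTopMinor (sampleComplex n 2 ω) (completeComplex t 2)} ≤
        2 ^ 84 * (n : ℝ≥0∞)⁻¹ := by
  have hn1 : (1 : ℝ) ≤ n := by exact_mod_cast hn
  set p := Real.sqrt ((1 / 6) ^ 8 / (n : ℝ)) with hp
  set s := ENNReal.ofReal (Real.sqrt (1 / (n : ℝ))) with hs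
  have hp0 : 0 ≤ p := Real.sqrt_nonneg _
  have hp1 : p ≤ 1 := Real.sqrt_le_one.2 (by rw [div_le_one (by linarith)]; norm_num; linarith)
  have hs1 : s ≤ 1 := ENNReal.ofReal_le_one.2
    (Real.sqrt_le_one.2 (by rw [div_le_one (by linarith)]; exact hn1))
  have hs2 : s ^ 2 = (n : ℝ≥0∞)⁻¹ := by
    rw [hs, ← ENNReal.ofReal_pow (Real.sqrt_nonneg _), Real.sq_sqrt (by positivity), one_div,
      ENNReal.ofReal_inv_of_pos (by linarith), ENNReal.ofReal_natCast]
  have hps : ENNReal.ofReal p = 6⁻¹ ^ 4 * s := by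
    have h6 : (6⁻¹ : ℝ≥0∞) = ENNReal.ofReal (1 / 6) := by
      rw [one_div, ENNReal.ofReal_inv_of_pos (by norm_num)]
      simp
    rw [h6, ← ENNReal.ofReal_pow (by norm_num), hs, ← ENNReal.ofReal_mul (by norm_num), hp,
      div_eq_mul_one_div, Real.sqrt_mul (by norm_num),
      show ((1 / 6 : ℝ)) ^ 8 = ((1 / 6) ^ 4) ^ 2 by norm_num, Real.sqrt_sq (by norm_num)]
  have hcard : (Fintype.card (Fin n) : ℝ≥0∞) * s ^ 2 = 1 := by
    rw [hs2, Fintype.card_fin]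
    exact ENNReal.mul_inv_cancel (by exact_mod_cast hn.ne') (ENNReal.natCast_ne_top n)
  have hsub : {ω | ContainsTopMinor (sampleComplex n 2 ω) (completeComplex t 2)} ⊆
      ⋃ d : SweepData (Fin n), {ω | d.IsValid ∧ ↑d.triangleFinset ⊆ sampleComplex n 2 ω} := by
    intro ω hω
    obtain ⟨d, hd, hd'⟩ := hω.exists_sweepData ht
    exact Set.mem_iUnion.2 ⟨d, hd, SweepData.triangleFinset_subset_iff.2 hd'⟩
  rw [← hs2]
  refine (measure_mono hsub).trans ((measure_iUnion_le _).trans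
    ((ENNReal.tsum_le_tsum fun d => ?_).trans (SweepData.tsum_weight_le hcard (pow_le_one' hs1 2))))
  by_cases hd : d.IsValid
  · simp only [hd, true_and]
    refine (complexMeasure_subset_le hp0 hp1 hd.card_eq_three).trans ?_
    rw [hps]
    exact hd.pow_card_le_weight hs1
  · simp [hd]

end Probability

/-- There is a constant `c < 1` such that for every `t ≥ 10` the random 2-complex
`X^2(n,p)` with `p = √(c/n)` a.a.s. does not contain `K_t^2` as a topological minor. -/
theorem topMinor_lower_bound :
    ∃ c : ℝ, 0 < c ∧ c < 1 ∧
      ∀ t : ℕ, 10 ≤ t →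
        Tendsto
          (fun n : ℕ => complexMeasure n 2 (Real.sqrt (c / (n : ℝ)))
            {ω | ¬ ContainsTopMinor (sampleComplex n 2 ω) (completeComplex t 2)})
          atTop (nhds 1) := by
  refine ⟨(1 / 6) ^ 8, by norm_num, by norm_num, fun t ht => ?_⟩
  have hlim : Tendsto (fun n : ℕ => 1 - 2 ^ 84 * (n : ENNReal)⁻¹) atTop (nhds 1) := by
    have h := ENNReal.Tendsto.sub (tendsto_const_nhds (x := (1 : ENNReal)) (f := atTop))
      (ENNReal.Tendsto.const_mul (a := 2 ^ 84) ENNReal.tendsto_inv_nat_nhds_zero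
        (Or.inr (by finiteness))) (Or.inl ENNReal.one_ne_top)
    simpa using h
  have hprob : ∀ n : ℕ, 0 < n →
      IsProbabilityMeasure (complexMeasure n 2 (Real.sqrt ((1 / 6) ^ 8 / (n : ℝ)))) := by
    intro n hn
    have hn1 : (1 : ℝ) ≤ n := by exact_mod_cast hn
    exact isProbabilityMeasure_complexMeasure n 2 (Real.sqrt_nonneg _)
      (Real.sqrt_le_one.2 (by rw [div_le_one (by linarith)]; norm_num; linarith))
  refine tendsto_of_tendsto_of_tendsto_of_le_of_le' hlim tendsto_const_nhds ?_ ?_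
  · filter_upwards [eventually_gt_atTop 0] with n hn
    have := hprob n hn
    have hcompl := prob_compl_eq_one_sub
      (μ := complexMeasure n 2 (Real.sqrt ((1 / 6) ^ 8 / (n : ℝ))))
      (s := {ω | ContainsTopMinor (sampleComplex n 2 ω) (completeComplex t 2)})
      (Set.toFinite _).measurableSet
    rw [← Set.compl_ofPred, hcompl]
    exact tsub_le_tsub_left (complexMeasure_containsTopMinor_le hn (by omega)) 1
  · filter_upwards [eventually_gt_atTop 0] with n hn
    have := hprob n hn
    exact prob_le_one
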